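/- arXiv:1607.06173 — 10 statements merged into one kernel-verified Lean document; each statement's English description precedes it below -/
import Mathlib

section
/- Let n ≥ 1, let a ∈ ℝⁿ be a nonzero vector with nonnegative integer entries, let 0 < ε < 1, and let 0 < β < 1 satisfy 1 − β ≤ ε/(n·‖a‖₁). Then (1 − ε)·Vol(P_a) ≤ Vol(⋃_{k=0}^∞ Q_k) ≤ Vol(P_a). -/
open MeasureTheory

/-- The cross-polytope (closed `L¹`-ball) of radius `r` centered at `c` in `ℝⁿ`. -/
def crossPolytope {n : ℕ} (c : Fin n → ℝ) (r : ℝ) : Set (Fin n → ℝ) :=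
  {x | ∑ i, |x i - c i| ≤ r}

/-- The knapsack dual polytope `P_a = conv{±e₁, …, ±eₙ, a}`. -/
def knapsackDual {n : ℕ} (a : Fin n → ℝ) : Set (Fin n → ℝ) :=
  convexHull ℝ (({a} : Set (Fin n → ℝ)) ∪
    ⋃ i : Fin n, ({Pi.single i (1 : ℝ), -Pi.single i (1 : ℝ)} : Set (Fin n → ℝ)))


theorem aux_exists_t {n : ℕ} (a x : Fin n → ℝ) (hx : x ∈ knapsackDual a) :
    ∃ t : ℝ, 0 ≤ t ∧ t ≤ 1 ∧ ∑ i, |x i - (1 - t) * a i| ≤ t := by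
  have hconv : Convex ℝ {x : Fin n → ℝ |
      ∃ t : ℝ, 0 ≤ t ∧ t ≤ 1 ∧ ∑ i, |x i - (1 - t) * a i| ≤ t} := by
    rintro x ⟨t, ht0, ht1, hx⟩ y ⟨s, hs0, hs1, hy⟩ p q hp hq hpq
    refine ⟨p * t + q * s, by positivity, by nlinarith, ?_⟩
    calc ∑ i, |(p • x + q • y) i - (1 - (p * t + q * s)) * a i|
        ≤ ∑ i, (p * |x i - (1 - t) * a i| + q * |y i - (1 - s) * a i|) := by
          refine Finset.sum_le_sum fun i _ => ?_
          have h : (p • x + q • y) i - (1 - (p * t + q * s)) * a i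
              = p * (x i - (1 - t) * a i) + q * (y i - (1 - s) * a i) := by
            simp only [Pi.add_apply, Pi.smul_apply, smul_eq_mul]
            linear_combination (a i) * hpq
          rw [h]
          refine (abs_add_le _ _).trans ?_
          rw [abs_mul, abs_mul, abs_of_nonneg hp, abs_of_nonneg hq]
      _ = p * ∑ i, |x i - (1 - t) * a i| + q * ∑ i, |y i - (1 - s) * a i| := by
          rw [Finset.sum_add_distrib, Finset.mul_sum, Finset.mul_sum]
      _ ≤ p * t + q * s := by gcongr
  refine convexHull_min ?_ hconv hx
  rintro y (hy | hy)
  · rw [Set.mem_singleton_iff] at hy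
    subst hy
    exact ⟨0, le_rfl, zero_le_one, by simp⟩
  · obtain ⟨i, hi⟩ := Set.mem_iUnion.1 hy
    refine ⟨1, zero_le_one, le_rfl, ?_⟩
    have : ∀ j, |(Pi.single i (1 : ℝ) : Fin n → ℝ) j| = if j = i then 1 else 0 := by
      intro j
      by_cases h : j = i
      · subst h; simp
      · simp [h]
    rcases hi with rfl | hi
    · simp [this]
    · rw [Set.mem_singleton_iff] at hi
      subst hi
      simp [this]

theorem aux_cross {n : ℕ} (hn : 1 ≤ n) (a y : Fin n → ℝ) (hy : ∑ i, |y i| ≤ 1) :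
    y ∈ knapsackDual a := by
  have hc : Convex ℝ (knapsackDual a) := convex_convexHull ℝ _
  have hn' : (0 : ℝ) < n := by exact_mod_cast hn
  have hz : ∀ (i : Fin n) (c : ℝ), |c| ≤ 1 → c • (Pi.single i (1 : ℝ) : Fin n → ℝ) ∈ knapsackDual a := by
    intro i c h
    obtain ⟨h1, h2⟩ := abs_le.1 h
    have hp : (Pi.single i (1 : ℝ) : Fin n → ℝ) ∈ knapsackDual a :=
      subset_convexHull ℝ _ (Or.inr (Set.mem_iUnion.2 ⟨i, Or.inl rfl⟩))
    have hm : -(Pi.single i (1 : ℝ) : Fin n → ℝ) ∈ knapsackDual a :=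
      subset_convexHull ℝ _ (Or.inr (Set.mem_iUnion.2 ⟨i, Or.inr rfl⟩))
    have := hc hp hm (a := (1 + c) / 2) (b := (1 - c) / 2) (by linarith) (by linarith) (by ring)
    convert this using 1
    module
  have hd : 0 ≤ (1 - ∑ i, |y i|) / n := div_nonneg (by linarith) hn'.le
  set d := (1 - ∑ i, |y i|) / n with hdd
  have hs : ∑ i, (|y i| + d) = 1 := by
    rw [Finset.sum_add_distrib]
    simp only [Finset.sum_const, Finset.card_univ, Fintype.card_fin, nsmul_eq_mul]
    rw [hdd]; field_simp; ring
  have := hc.sum_mem (t := Finset.univ) (w := fun i => |y i| + d)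
    (z := fun i => (y i / (|y i| + d)) • (Pi.single i (1 : ℝ) : Fin n → ℝ))
    (fun i _ => by positivity) hs (fun i _ => hz i _ (by
      rw [abs_div, abs_of_nonneg (by positivity : 0 ≤ |y i| + d)]
      exact div_le_one_of_le₀ (by linarith) (by positivity)))
  convert this using 1
  ext j
  simp only [Finset.sum_apply, Pi.smul_apply, smul_eq_mul]
  rw [Finset.sum_eq_single j]
  · simp only [Pi.single_eq_same, mul_one]
    by_cases h : |y j| + d = 0
    · have : |y j| = 0 := by linarith [abs_nonneg (y j)]
      simp [abs_eq_zero.1 this]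
    · field_simp
  · intro b _ hb
    simp [Pi.single_eq_of_ne hb.symm]
  · simp

theorem aux_Q_sub {n : ℕ} (hn : 1 ≤ n) (a : Fin n → ℝ) (t : ℝ) (ht0 : 0 < t) (ht1 : t ≤ 1) :
    crossPolytope ((1 - t) • a) t ⊆ knapsackDual a := by
  intro x hx
  have hx' : ∑ i, |x i - (1 - t) * a i| ≤ t := by
    simpa [crossPolytope] using hx
  have hc : Convex ℝ (knapsackDual a) := convex_convexHull ℝ _
  have ha : a ∈ knapsackDual a := subset_convexHull ℝ _ (Or.inl rfl)
  have hy : t⁻¹ • (x - (1 - t) • a) ∈ knapsackDual a := by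
    apply aux_cross hn
    simp only [Pi.smul_apply, Pi.sub_apply, smul_eq_mul, abs_mul, ← Finset.mul_sum]
    rw [abs_of_pos (inv_pos.2 ht0), inv_mul_le_iff₀ ht0]
    linarith
  have := hc ha hy (a := 1 - t) (b := t) (by linarith) ht0.le (by ring)
  convert this using 1
  rw [smul_smul, mul_inv_cancel₀ ht0.ne', one_smul]
  abel

theorem aux_bdd {n : ℕ} (a : Fin n → ℝ) : volume (knapsackDual a) ≠ ⊤ := by
  have : Bornology.IsBounded (knapsackDual a) := by
    unfold knapsackDual
    rw [isBounded_convexHull]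
    apply Set.Finite.isBounded
    exact (Set.finite_singleton _).union (Set.finite_iUnion fun i => Set.toFinite _)
  exact this.measure_lt_top.ne

open Pointwise in
theorem aux_scale {n : ℕ} (a : Fin n → ℝ) (δ β : ℝ) (hδ0 : 0 < δ) (hδ1 : δ ≤ 1)
    (hβ0 : 0 < β) (hβ1 : β < 1) (hβ : (1 - β) * ∑ i, |a i| ≤ δ) :
    (1 - δ) • knapsackDual a ⊆ ⋃ k : ℕ, crossPolytope ((1 - β ^ k) • a) (β ^ k) := by
  rintro _ ⟨x, hx, rfl⟩
  obtain ⟨t, ht0, ht1, hxt⟩ := aux_exists_t a x hx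
  have hl : 0 ≤ 1 - δ := by linarith
  obtain ⟨k, hk1, hk2⟩ := exists_nat_pow_near_of_lt_one (x := δ + (1 - δ) * t) (y := β)
    (by positivity) (by nlinarith) hβ0 hβ1
  refine Set.mem_iUnion.2 ⟨k, ?_⟩
  have hA : 0 ≤ ∑ i, |a i| := Finset.sum_nonneg fun i _ => abs_nonneg _
  have hk0 : 0 < β ^ k := by positivity
  have hk3 : β ^ k ≤ 1 := pow_le_one₀ hβ0.le hβ1.le
  set u := δ + (1 - δ) * t with hu
  change ∑ i, |((1 - δ) • x) i - ((1 - β ^ k) • a) i| ≤ β ^ k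
  calc ∑ i, |((1 - δ) • x) i - ((1 - β ^ k) • a) i|
      ≤ ∑ i, ((1 - δ) * |x i - (1 - t) * a i| + (β ^ k - u) * |a i|) := by
        refine Finset.sum_le_sum fun i _ => ?_
        have h : ((1 - δ) • x) i - ((1 - β ^ k) • a) i
            = (1 - δ) * (x i - (1 - t) * a i) + (β ^ k - u) * a i := by
          simp only [Pi.smul_apply, smul_eq_mul, hu]
          ring
        rw [h]
        refine (abs_add_le _ _).trans ?_
        rw [abs_mul, abs_mul, abs_of_nonneg hl, abs_of_nonneg (by linarith : 0 ≤ β ^ k - u)]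
    _ = (1 - δ) * ∑ i, |x i - (1 - t) * a i| + (β ^ k - u) * ∑ i, |a i| := by
        rw [Finset.sum_add_distrib, Finset.mul_sum, Finset.mul_sum]
    _ ≤ (1 - δ) * t + (β ^ k * (1 - β)) * ∑ i, |a i| := by
        gcongr
        rw [pow_succ] at hk1
        linarith
    _ ≤ (1 - δ) * t + δ := by
        have : β ^ k * ((1 - β) * ∑ i, |a i|) ≤ 1 * δ := by
          gcongr
        linarith
    _ ≤ β ^ k := by linarith

theorem stmt0 (n : ℕ) (hn : 1 ≤ n) (a : Fin n → ℝ) (ha : a ≠ 0)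
    (haint : ∀ i, ∃ m : ℕ, a i = (m : ℝ))
    (ε β : ℝ) (hε0 : 0 < ε) (hε1 : ε < 1) (hβ0 : 0 < β) (hβ1 : β < 1)
    (hβ : 1 - β ≤ ε / (n * ∑ i, |a i|)) :
    (1 - ε) * (volume (knapsackDual a)).toReal
      ≤ (volume (⋃ k : ℕ, crossPolytope ((1 - β ^ k) • a) (β ^ k))).toReal ∧
    (volume (⋃ k : ℕ, crossPolytope ((1 - β ^ k) • a) (β ^ k))).toReal
      ≤ (volume (knapsackDual a)).toReal := by
  have hn' : (0 : ℝ) < n := by exact_mod_cast hn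
  have hn1 : (1 : ℝ) ≤ n := by exact_mod_cast hn
  have hsub : (⋃ k : ℕ, crossPolytope ((1 - β ^ k) • a) (β ^ k)) ⊆ knapsackDual a :=
    Set.iUnion_subset fun k =>
      aux_Q_sub hn a (β ^ k) (by positivity) (pow_le_one₀ hβ0.le hβ1.le)
  have hfin := aux_bdd a
  have hfin' := measure_ne_top_of_subset hsub hfin
  refine ⟨?_, ENNReal.toReal_mono hfin (measure_mono hsub)⟩
  have hA : 0 < ∑ i, |a i| := by
    obtain ⟨i, hi⟩ := Function.ne_iff.1 ha
    exact Finset.sum_pos' (fun i _ => abs_nonneg _) ⟨i, Finset.mem_univ _, abs_pos.2 hi⟩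
  have hδ1 : ε / n ≤ 1 := by rw [div_le_one hn']; linarith
  have hsc := aux_scale a (ε / n) β (by positivity) hδ1 hβ0 hβ1 (by
    rw [le_div_iff₀ (by positivity)] at hβ
    rw [le_div_iff₀ hn']
    linarith)
  have h := ENNReal.toReal_mono hfin' (measure_mono (μ := volume) hsc)
  rw [Measure.addHaar_smul, ENNReal.toReal_mul, ENNReal.toReal_ofReal (abs_nonneg _),
    Module.finrank_fintype_fun_eq_card, Fintype.card_fin,
    abs_of_nonneg (pow_nonneg (by linarith) _)] at h
  refine le_trans ?_ h
  gcongr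
  have hb := one_add_mul_le_pow (a := -(ε / n)) (by linarith) n
  have e : (n : ℝ) * (ε / n) = ε := by field_simp
  rw [← sub_eq_add_neg] at hb
  linarith
end

section
/- For every a ∈ ℝⁿ and every β with 0 < β < 1, P_a is contained in (⋃_{k=0}^∞ conv(Q_k ∪ Q_{k+1})) ∪ {a}. -/
open MeasureTheory

theorem stmt2 (n : ℕ) (hn : 1 ≤ n) (a : Fin n → ℝ)
    (β : ℝ) (hβ0 : 0 < β) (hβ1 : β < 1) :
    knapsackDual a ⊆
      (⋃ k : ℕ, convexHull ℝ
        (crossPolytope ((1 - β ^ k) • a) (β ^ k) ∪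
         crossPolytope ((1 - β ^ (k + 1)) • a) (β ^ (k + 1)))) ∪ {a} := by
  have hT : knapsackDual a ⊆ {x | ∃ s : ℝ, 0 ≤ s ∧ s ≤ 1 ∧ ∑ i, |x i - (1 - s) * a i| ≤ s} := by
    apply convexHull_min
    · rintro x (hx | hx)
      · rw [Set.mem_singleton_iff] at hx
        subst hx
        exact ⟨0, le_refl _, zero_le_one, by simp⟩
      · rw [Set.mem_iUnion] at hx
        obtain ⟨j, hj⟩ := hx
        refine ⟨1, zero_le_one, le_refl _, ?_⟩
        have key : ∑ i, |(Pi.single j (1 : ℝ) : Fin n → ℝ) i| ≤ 1 := by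
          rw [Finset.sum_eq_single j]
          · simp
          · intro b _ hb
            simp [hb]
          · simp
        rcases hj with hj | hj
        · subst hj
          simpa using key
        · rw [Set.mem_singleton_iff] at hj
          subst hj
          simpa using key
    · rintro x ⟨s, hs0, hs1, hs⟩ y ⟨t, ht0, ht1, ht⟩ p q hp hq hpq
      refine ⟨p * s + q * t, by positivity, by nlinarith, ?_⟩
      calc ∑ i, |(p • x + q • y) i - (1 - (p * s + q * t)) * a i|
          ≤ ∑ i, (p * |x i - (1 - s) * a i| + q * |y i - (1 - t) * a i|) := by
            apply Finset.sum_le_sum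
            intro i _
            have e : (p • x + q • y) i - (1 - (p * s + q * t)) * a i
                = p * (x i - (1 - s) * a i) + q * (y i - (1 - t) * a i) := by
              simp only [Pi.add_apply, Pi.smul_apply, smul_eq_mul]
              linear_combination (a i) * hpq
            rw [e]
            refine (abs_add_le _ _).trans ?_
            rw [abs_mul, abs_mul, abs_of_nonneg hp, abs_of_nonneg hq]
        _ = p * ∑ i, |x i - (1 - s) * a i| + q * ∑ i, |y i - (1 - t) * a i| := by
            rw [Finset.sum_add_distrib, Finset.mul_sum, Finset.mul_sum]
        _ ≤ p * s + q * t := by gcongr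
  intro x hx
  obtain ⟨s, hs0, hs1, hs⟩ := hT hx
  rcases hs0.eq_or_lt with h0 | hpos
  · right
    subst h0
    rw [Set.mem_singleton_iff]
    funext i
    have h1 : |x i - (1 - 0) * a i| ≤ 0 :=
      (Finset.single_le_sum (f := fun i => |x i - (1 - 0) * a i|)
        (fun i _ => abs_nonneg _) (Finset.mem_univ i)).trans hs
    have h2 := abs_nonpos_iff.mp h1
    linarith
  · left
    obtain ⟨k, hk1, hk2⟩ := exists_nat_pow_near_of_lt_one hpos hs1 hβ0 hβ1
    rw [Set.mem_iUnion]
    refine ⟨k, ?_⟩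
    have mem : ∀ r : ℝ, 0 < r →
        ((1 - r) • a + (r / s) • (x - (1 - s) • a)) ∈ crossPolytope ((1 - r) • a) r := by
      intro r hr
      have e : ∀ i, |((1 - r) • a + (r / s) • (x - (1 - s) • a)) i - ((1 - r) • a) i|
          = (r / s) * |x i - (1 - s) * a i| := by
        intro i
        have : 0 ≤ r / s := by positivity
        simp [abs_mul, abs_of_pos hr, abs_of_pos hpos, abs_div]
      simp only [crossPolytope, Set.mem_setOf_eq, e]
      rw [← Finset.mul_sum]
      calc r / s * ∑ i, |x i - (1 - s) * a i| ≤ r / s * s := by gcongr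
        _ = r := by field_simp
    have A := subset_convexHull ℝ _ (Set.mem_union_left
      (crossPolytope ((1 - β ^ (k + 1)) • a) (β ^ (k + 1))) (mem (β ^ k) (by positivity)))
    have B := subset_convexHull ℝ _ (Set.mem_union_right
      (crossPolytope ((1 - β ^ k) • a) (β ^ k)) (mem (β ^ (k + 1)) (by positivity)))
    generalize hu : β ^ k = u at *
    generalize hv : β ^ (k + 1) = v at *
    have huv : 0 < u - v := by linarith
    have hc := (convex_convexHull ℝ _) A B (a := (s - v) / (u - v)) (b := (u - s) / (u - v))
      (div_nonneg (by linarith) huv.le) (div_nonneg (by linarith) huv.le)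
      (by field_simp; ring)
    convert hc using 1
    funext i
    simp only [Pi.add_apply, Pi.smul_apply, Pi.sub_apply, smul_eq_mul]
    field_simp
    ring
end

section
/- For every a ∈ ℝⁿ, every β with 0 < β < 1, and every m ∈ ℕ, one has (⋃_{k=0}^m Q_k) ∩ Q_{m+1} = Q_m ∩ Q_{m+1}. -/
open MeasureTheory

theorem stmt3 (n : ℕ) (hn : 1 ≤ n) (a : Fin n → ℝ)
    (β : ℝ) (hβ0 : 0 < β) (hβ1 : β < 1) (m : ℕ)
    (Q : ℕ → Set (Fin n → ℝ))
    (hQ : ∀ k, Q k = crossPolytope ((1 - β ^ k) • a) (β ^ k)) :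
    (⋃ k ≤ m, Q k) ∩ Q (m + 1) = Q m ∩ Q (m + 1) := by
  have key : ∀ (x : Fin n → ℝ) (s t u : ℝ), s < t → t ≤ u →
      ∑ i, |x i - ((1 - s) • a) i| ≤ s → ∑ i, |x i - ((1 - u) • a) i| ≤ u →
      ∑ i, |x i - ((1 - t) • a) i| ≤ t := by
    intro x s t u hst htu hs hu
    have h : (u - s) * ∑ i, |x i - ((1 - t) • a) i| ≤
        (u - t) * ∑ i, |x i - ((1 - s) • a) i| + (t - s) * ∑ i, |x i - ((1 - u) • a) i| := by
      rw [Finset.mul_sum, Finset.mul_sum, Finset.mul_sum, ← Finset.sum_add_distrib]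
      refine Finset.sum_le_sum fun i _ => ?_
      simp only [Pi.smul_apply, smul_eq_mul]
      have e1 := abs_of_nonneg (show 0 ≤ u - s by linarith)
      have e2 := abs_of_nonneg (show 0 ≤ u - t by linarith)
      have e3 := abs_of_nonneg (show 0 ≤ t - s by linarith)
      calc (u - s) * |x i - (1 - t) * a i| = |(u - s) * (x i - (1 - t) * a i)| := by
            rw [abs_mul, e1]
        _ = |(u - t) * (x i - (1 - s) * a i) + (t - s) * (x i - (1 - u) * a i)| := by
            congr 1; ring
        _ ≤ |(u - t) * (x i - (1 - s) * a i)| + |(t - s) * (x i - (1 - u) * a i)| :=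
            abs_add_le _ _
        _ = _ := by rw [abs_mul, abs_mul, e2, e3]
    have h1 := mul_le_mul_of_nonneg_left hs (show 0 ≤ u - t by linarith)
    have h2 := mul_le_mul_of_nonneg_left hu (show 0 ≤ t - s by linarith)
    have h3 : 0 < u - s := by linarith
    refine le_of_mul_le_mul_left ?_ h3
    linarith
  ext x
  simp only [Set.mem_inter_iff, Set.mem_iUnion, exists_prop]
  constructor
  · rintro ⟨⟨k, hk, hxk⟩, hx⟩
    refine ⟨?_, hx⟩
    rw [hQ] at hxk hx ⊢
    exact key x (β ^ (m + 1)) (β ^ m) (β ^ k)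
      (pow_lt_pow_right_of_lt_one₀ hβ0 hβ1 (Nat.lt_succ_self m))
      (pow_le_pow_of_le_one hβ0.le hβ1.le hk) hx hxk
  · rintro ⟨h1, h2⟩
    exact ⟨⟨m, le_rfl, h1⟩, h2⟩
end

section
/- For every a ∈ ℝⁿ and every β with 0 < β < 1, Vol(⋃_{k=0}^∞ Q_k) = (1/(1−βⁿ)) · (2ⁿ/n! − Vol(Q_0 ∩ Q_1)). -/
open MeasureTheory

lemma cp_vol (n : ℕ) (hn : 1 ≤ n) (r : ℝ) :
    volume (crossPolytope (0 : Fin n → ℝ) r) =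
      ENNReal.ofReal r ^ n * ENNReal.ofReal ((2 : ℝ) ^ n / (n.factorial : ℝ)) := by
  have : Nonempty (Fin n) := ⟨⟨0, hn⟩⟩
  have h := MeasureTheory.volume_sum_rpow_le (Fin n) (p := 1) le_rfl r
  simp only [Real.rpow_one, div_one, Fintype.card_fin, Real.Gamma_nat_eq_factorial] at h
  have h2 : Real.Gamma (1 + 1) = 1 := by
    have := Real.Gamma_nat_eq_factorial 1
    simpa using this
  rw [h2, mul_one] at h
  rw [← h]
  simp [crossPolytope]

lemma cp_image {n : ℕ} (a c : Fin n → ℝ) (β r : ℝ) (hβ0 : 0 < β) :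
    AffineMap.homothety a β '' crossPolytope c r =
      crossPolytope (β • (c - a) + a) (β * r) := by
  have key : ∀ x y : Fin n → ℝ, ∑ i, |(β • (x - a) + a) i - (β • (y - a) + a) i|
      = β * ∑ i, |x i - y i| := by
    intro x y
    rw [Finset.mul_sum]
    refine Finset.sum_congr rfl fun i _ => ?_
    rw [← abs_of_pos hβ0, ← abs_mul, abs_of_pos hβ0]
    congr 1
    simp only [Pi.add_apply, Pi.smul_apply, Pi.sub_apply, smul_eq_mul]
    ring
  ext y
  simp only [crossPolytope, Set.mem_image, Set.mem_ofPred_eq, AffineMap.homothety_apply,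
    vsub_eq_sub, vadd_eq_add]
  constructor
  · rintro ⟨x, hx, rfl⟩
    rw [key]
    exact mul_le_mul_of_nonneg_left hx hβ0.le
  · intro hy
    have e : β • ((β⁻¹ • (y - a) + a) - a) + a = y := by
      rw [add_sub_cancel_right, smul_smul, mul_inv_cancel₀ hβ0.ne', one_smul, sub_add_cancel]
    refine ⟨β⁻¹ • (y - a) + a, ?_, e⟩
    rw [← e, key] at hy
    exact le_of_mul_le_mul_left hy hβ0

lemma cp_meas {n : ℕ} (c : Fin n → ℝ) (r : ℝ) : MeasurableSet (crossPolytope c r) := by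
  apply IsClosed.measurableSet
  exact isClosed_le (by fun_prop) continuous_const

lemma cp_convex {n : ℕ} (a x : Fin n → ℝ) (t β : ℝ) (htβ : t ≤ β) (hβ1 : β < 1)
    (h0 : x ∈ crossPolytope ((1 - (1 : ℝ)) • a) 1) (ht : x ∈ crossPolytope ((1 - t) • a) t) :
    x ∈ crossPolytope ((1 - β) • a) β := by
  simp only [crossPolytope, Set.mem_ofPred_eq, Pi.smul_apply, smul_eq_mul] at *
  have h1t : 0 < 1 - t := by linarith
  have : (1 - t) * ∑ i, |x i - (1 - β) * a i| ≤
      (β - t) * ∑ i, |x i - (1 - 1) * a i| + (1 - β) * ∑ i, |x i - (1 - t) * a i| := by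
    simp only [Finset.mul_sum]
    rw [← Finset.sum_add_distrib]
    refine Finset.sum_le_sum fun i _ => ?_
    have e : (1 - t) * (x i - (1 - β) * a i) =
      (β - t) * (x i - (1 - 1) * a i) + (1 - β) * (x i - (1 - t) * a i) := by ring
    calc _ = |(1 - t) * (x i - (1 - β) * a i)| := by rw [abs_mul, abs_of_pos h1t]
      _ ≤ _ := by
        rw [e]
        refine (abs_add_le _ _).trans ?_
        rw [abs_mul, abs_mul, abs_of_nonneg (sub_nonneg.2 htβ), abs_of_pos (sub_pos.2 hβ1)]
  have h3 := mul_le_mul_of_nonneg_left h0 (sub_nonneg.2 htβ)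
  have h4 := mul_le_mul_of_nonneg_left ht (sub_pos.2 hβ1).le
  refine le_of_mul_le_mul_left ?_ h1t
  linarith

theorem stmt6 (n : ℕ) (hn : 1 ≤ n) (a : Fin n → ℝ)
    (β : ℝ) (hβ0 : 0 < β) (hβ1 : β < 1)
    (Q : ℕ → Set (Fin n → ℝ))
    (hQ : ∀ k, Q k = crossPolytope ((1 - β ^ k) • a) (β ^ k)) :
    (volume (⋃ k : ℕ, Q k)).toReal =
      (1 / (1 - β ^ n)) * ((2 : ℝ) ^ n / (n.factorial : ℝ) - (volume (Q 0 ∩ Q 1)).toReal) := by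
  have hstep : ∀ k, Q (k + 1) = AffineMap.homothety a β '' Q k := by
    intro k
    rw [hQ, hQ, cp_image _ _ _ _ hβ0, ← pow_succ']
    congr 1
    ext i
    simp only [Pi.add_apply, Pi.smul_apply, Pi.sub_apply, smul_eq_mul]
    ring
  have hm : ∀ k, MeasurableSet (Q k) := fun k => by rw [hQ]; exact cp_meas _ _
  set U := ⋃ k, Q k with hU
  have hTU : AffineMap.homothety a β '' U = ⋃ k, Q (k + 1) := by
    rw [hU, Set.image_iUnion]
    simp only [hstep]
  have hUd : U = Q 0 ∪ AffineMap.homothety a β '' U := by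
    rw [hTU, hU]; exact (sup_iSup_nat_succ Q).symm
  have hint : Q 0 ∩ AffineMap.homothety a β '' U = Q 0 ∩ Q 1 := by
    rw [hTU]
    ext x
    simp only [Set.mem_inter_iff, Set.mem_iUnion]
    constructor
    · rintro ⟨h0, k, hk⟩
      refine ⟨h0, ?_⟩
      rw [hQ] at h0 hk ⊢
      rw [pow_zero] at h0
      rw [pow_one]
      exact cp_convex a x _ β (pow_le_of_le_one hβ0.le hβ1.le (Nat.succ_ne_zero k)) hβ1 h0 hk
    · rintro ⟨h0, h1⟩
      exact ⟨h0, 0, h1⟩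
  have hv0 : volume (Q 0) = ENNReal.ofReal ((2 : ℝ) ^ n / (n.factorial : ℝ)) := by
    have := cp_vol n hn 1
    rw [hQ]; simpa using this
  have hfin : volume U ≠ ⊤ := by
    have hsub : U ⊆ crossPolytope 0 (1 + ∑ i, |a i|) := by
      intro x hx
      obtain ⟨k, hk⟩ := Set.mem_iUnion.1 hx
      rw [hQ] at hk
      simp only [crossPolytope, Set.mem_ofPred_eq, Pi.smul_apply, smul_eq_mul, Pi.zero_apply,
        sub_zero] at *
      have hb0 : 0 < β ^ k := pow_pos hβ0 k
      have hb1 : β ^ k ≤ 1 := pow_le_one₀ hβ0.le hβ1.le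
      have : ∑ i, |x i| ≤ ∑ i, |x i - (1 - β ^ k) * a i| + ∑ i, |a i| := by
        rw [← Finset.sum_add_distrib]
        refine Finset.sum_le_sum fun i _ => ?_
        have e := abs_add_le (x i - (1 - β ^ k) * a i) ((1 - β ^ k) * a i)
        rw [sub_add_cancel, abs_mul, abs_of_nonneg (sub_nonneg.2 hb1)] at e
        nlinarith [abs_nonneg (a i)]
      linarith
    refine ne_top_of_le_ne_top ?_ (measure_mono hsub)
    rw [cp_vol n hn]
    exact ENNReal.mul_ne_top (ENNReal.pow_ne_top ENNReal.ofReal_ne_top) ENNReal.ofReal_ne_top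
  have hvT : volume (AffineMap.homothety a β '' U) = ENNReal.ofReal (β ^ n) * volume U := by
    rw [Measure.addHaar_image_homothety]
    simp [abs_of_pos hβ0]
  have main := measure_union_add_inter' (μ := volume) (hm 0) (AffineMap.homothety a β '' U)
  rw [← hUd, hint, hvT, hv0] at main
  have hi : volume (Q 0 ∩ Q 1) ≠ ⊤ :=
    ne_top_of_le_ne_top (by rw [hv0]; exact ENNReal.ofReal_ne_top)
      (measure_mono Set.inter_subset_left)
  have m2 := congrArg ENNReal.toReal main
  rw [ENNReal.toReal_add hfin hi, ENNReal.toReal_add ENNReal.ofReal_ne_top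
    (ENNReal.mul_ne_top ENNReal.ofReal_ne_top hfin), ENNReal.toReal_mul,
    ENNReal.toReal_ofReal (by positivity), ENNReal.toReal_ofReal (by positivity)] at m2
  have hlt : β ^ n < 1 := pow_lt_one₀ hβ0.le hβ1 (by omega)
  have : 1 - β ^ n ≠ 0 := by linarith
  field_simp at m2 ⊢
  linarith
end

section
/- Let n ≥ 2, let r > 0, let 2 ≤ k ≤ n, and let c ∈ ℝⁿ be of the form c = (c_1, c_2, …, c_{k−1}, c_k, 0, …, 0) with all c_i ≥ 0. Let c' = (c_1, c_2, …, c_{k−1}, 0, 0, …, 0) be obtained from c by replacing the k-th coordinate with 0. Then Vol(C(0,1) ∩ C(c,r)) ≤ Vol(C(0,1) ∩ C(c',r)). -/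
open MeasureTheory

theorem cp_closed {n : ℕ} (c : Fin n → ℝ) (r : ℝ) : IsClosed (crossPolytope c r) := by
  unfold crossPolytope
  exact isClosed_le (by fun_prop) continuous_const

theorem slice_le (a b s : ℝ) :
    volume {t : ℝ | |t| ≤ a ∧ |t - s| ≤ b} ≤ volume {t : ℝ | |t| ≤ a ∧ |t| ≤ b} := by
  have h2 : {t : ℝ | |t| ≤ a ∧ |t| ≤ b} = Set.Icc (-(min a b)) (min a b) := by
    ext t
    rw [Set.mem_Icc, ← abs_le, le_min_iff]
    rfl
  rw [h2, Real.volume_Icc]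
  rcases le_total a b with h | h
  · rw [min_eq_left h, ← Real.volume_Icc]
    apply measure_mono
    intro t ht
    exact abs_le.mp ht.1
  · have : ENNReal.ofReal (min a b - -(min a b)) = volume (Set.Icc (s - b) (s + b)) := by
      rw [min_eq_right h, Real.volume_Icc]; congr 1; ring
    rw [this]
    apply measure_mono
    intro t ht
    have := abs_le.mp ht.2
    constructor <;> linarith [this.1, this.2]

theorem vol_slice {m : ℕ} (k : Fin (m+1)) (S : Set (Fin (m+1) → ℝ)) (hS : MeasurableSet S) :
    volume S = ∫⁻ y : Fin m → ℝ, volume {t : ℝ | k.insertNth t y ∈ S} := by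
  have h := (volume_preserving_piFinSuccAbove (fun _ : Fin (m+1) => ℝ) k).symm
  rw [← h.measure_preimage hS.nullMeasurableSet, Measure.volume_eq_prod,
    Measure.prod_apply_symm (h.measurable hS)]
  rfl

/-- `c = (c₁, …, c_{k-1}, c_k, 0, …, 0)` (1-indexed) corresponds, with 0-indexing by `Fin n`,
to `c` vanishing at all indices strictly greater than `k`; `c'` replaces the `k`-th coordinate
(0-indexed index `k`) by `0`. -/
theorem stmt7 (n : ℕ) (hn : 2 ≤ n) (r : ℝ) (hr : 0 < r)
    (k : Fin n) (hk : 1 ≤ (k : ℕ))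
    (c : Fin n → ℝ) (hcnn : ∀ i, 0 ≤ c i) (hczero : ∀ j, k < j → c j = 0) :
    (volume (crossPolytope (0 : Fin n → ℝ) 1 ∩ crossPolytope c r)).toReal
      ≤ (volume (crossPolytope (0 : Fin n → ℝ) 1 ∩
          crossPolytope (Function.update c k 0) r)).toReal := by
  apply ENNReal.toReal_mono
  · refine ne_top_of_le_ne_top
      (isCompact_closedBall (0 : Fin n → ℝ) 1).measure_lt_top.ne (measure_mono ?_)
    rintro x ⟨hx, -⟩
    rw [mem_closedBall_zero_iff, pi_norm_le_iff_of_nonneg zero_le_one]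
    intro i
    simp only [crossPolytope, Set.mem_setOf_eq, Pi.zero_apply, sub_zero] at hx
    exact (Finset.single_le_sum (f := fun i => |x i|) (fun i _ => abs_nonneg _)
      (Finset.mem_univ i)).trans hx
  · obtain ⟨m, rfl⟩ : ∃ m, n = m + 1 := ⟨n - 1, by omega⟩
    rw [vol_slice k _ ((cp_closed _ _).inter (cp_closed _ _)).measurableSet,
      vol_slice k _ ((cp_closed _ _).inter (cp_closed _ _)).measurableSet]
    apply lintegral_mono
    intro y
    have := slice_le (1 - ∑ i, |y i|) (r - ∑ i, |y i - c (k.succAbove i)|) (c k)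
    simp only [crossPolytope, Set.mem_inter_iff, Set.mem_setOf_eq, Fin.sum_univ_succAbove _ k,
      Fin.insertNth_apply_same, Fin.insertNth_apply_succAbove, Pi.zero_apply, sub_zero,
      Function.update_self, ne_eq, Fin.succAbove_ne, not_false_eq_true, Function.update_of_ne]
    simpa only [le_sub_iff_add_le] using this
end

section
/- Let n ≥ 1 and suppose r and c are real numbers with 0 < r < 1 and 0 < c < 1 + r. Then C(0,1) ∩ C((c,0,…,0), r) ⊆ C(((1+(c−r))/2, 0, …, 0), (1−(c−r))/2). -/
open MeasureTheory

theorem stmt9 (n : ℕ) (hn : 0 < n) (r c : ℝ) (hr0 : 0 < r) (hr1 : r < 1)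
    (hc0 : 0 < c) (hc1 : c < 1 + r) :
    crossPolytope (0 : Fin n → ℝ) 1 ∩ crossPolytope (Pi.single (⟨0, hn⟩ : Fin n) c) r ⊆
      crossPolytope (Pi.single (⟨0, hn⟩ : Fin n) ((1 + (c - r)) / 2)) ((1 - (c - r)) / 2) := by
  rintro x ⟨h1, h2⟩
  simp only [crossPolytope, Set.mem_ofPred_eq] at h1 h2 ⊢
  have key : ∀ a : ℝ, ∑ i, |x i - (Pi.single (⟨0, hn⟩ : Fin n) a : Fin n → ℝ) i|
      = |x ⟨0, hn⟩ - a| + ∑ i ∈ Finset.univ.erase (⟨0, hn⟩ : Fin n), |x i| := by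
    intro a
    rw [← Finset.add_sum_erase _ _ (Finset.mem_univ (⟨0, hn⟩ : Fin n))]
    rw [Pi.single_eq_same]
    congr 1
    · refine Finset.sum_congr rfl fun i hi => ?_
      rw [Pi.single_eq_of_ne (Finset.ne_of_mem_erase hi), sub_zero]
  have h0 := key 0
  rw [Pi.single_zero] at h0
  rw [h0] at h1
  rw [key] at h2 ⊢
  have a1 := le_abs_self (x ⟨0, hn⟩ - 0)
  have a2 := neg_abs_le (x ⟨0, hn⟩ - c)
  rcases abs_cases (x ⟨0, hn⟩ - (1 + (c - r)) / 2) with ⟨h, _⟩ | ⟨h, _⟩ <;> rw [h] <;> linarith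
end

section
/- Let n ≥ 1 and let a ∈ ℤⁿ satisfy a_1 ≥ a_2 ≥ ⋯ ≥ a_n ≥ 0 and a_1 ≥ 1. Let ε > 0 and c₂ > 0 satisfy 0 < c₂·ε < 1 and ε < 1, and let 0 < β < 1 satisfy 1 − β ≥ c₂·ε/(n·‖a‖₁). If a real number Z satisfies Vol(Q_0 ∩ Q_1) ≤ Z ≤ (1 + c₂·ε²/(2n))·Vol(Q_0 ∩ Q_1), then (1−ε)·(2ⁿ/n! − Vol(Q_0 ∩ Q_1)) ≤ 2ⁿ/n! − Z ≤ 2ⁿ/n! − Vol(Q_0 ∩ Q_1). -/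
open MeasureTheory

theorem vol_pre_sub {n : ℕ} (w : Fin n → ℝ) (S : Set (Fin n → ℝ)) :
    volume ((fun x => x - w) ⁻¹' S) = volume S := by
  simp only [sub_eq_add_neg]
  exact measure_preimage_add_right volume (-w) S

theorem vol_cp {n : ℕ} (hn : 0 < n) (c : Fin n → ℝ) (r : ℝ) :
    volume (crossPolytope c r) = ENNReal.ofReal r ^ n * ENNReal.ofReal (2 ^ n / n.factorial) := by
  have : Nonempty (Fin n) := ⟨⟨0, hn⟩⟩
  have h := volume_sum_rpow_le (Fin n) (p := 1) le_rfl r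
  have h2 : crossPolytope c r = (fun x => x - c) ⁻¹' {x : Fin n → ℝ | (∑ i, |x i| ^ (1:ℝ)) ^ (1 / (1:ℝ)) ≤ r} := by
    ext x
    simp [crossPolytope]
  rw [h2, vol_pre_sub, h]
  simp [Real.Gamma_nat_eq_factorial, Real.Gamma_two, one_add_one_eq_two]

theorem vol_inter {n : ℕ} (i0 : Fin n) (v : Fin n → ℝ) (b : ℝ) (hb : b ≤ 1) :
    volume (crossPolytope 0 1 ∩ crossPolytope v b) ≤
      volume (crossPolytope (Pi.single i0 (v i0 / 2)) (1 - v i0 / 2)) := by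
  set h := v i0 with hh
  set C := crossPolytope (Pi.single i0 (h / 2)) (1 - h / 2) with hC
  set H : Set (Fin n → ℝ) := {x | x i0 < h / 2} with hH
  have mH : MeasurableSet H := measurableSet_lt (measurable_pi_apply i0) measurable_const
  set w : Fin n → ℝ := Function.update v i0 0 with hw
  have key : ∀ (c x : Fin n → ℝ) , ∑ i, |x i - c i| = |x i0 - c i0| + ∑ i ∈ Finset.univ.erase i0, |x i - c i| := by
    intro c x
    rw [Finset.add_sum_erase _ (fun i => |x i - c i|) (Finset.mem_univ i0)]
  rw [← measure_inter_add_diff _ mH, ← measure_inter_add_diff C mH]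
  refine add_le_add ?_ (measure_mono ?_)
  · rw [← vol_pre_sub w (C ∩ H)]
    refine measure_mono ?_
    rintro x ⟨⟨_, hx⟩, hxH⟩
    simp only [hC, hH, crossPolytope, Set.mem_setOf_eq, Set.mem_preimage, Set.mem_inter_iff, key] at hx hxH ⊢
    have e : ∑ i ∈ Finset.univ.erase i0, |(x - w) i - (Pi.single i0 (h / 2) : Fin n → ℝ) i| = ∑ i ∈ Finset.univ.erase i0, |x i - v i| := by
      refine Finset.sum_congr rfl fun i hi => ?_
      have := Finset.ne_of_mem_erase hi
      simp [hw, this]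
    rw [e]
    have hxi : (x - w) i0 = x i0 := by simp [hw]
    rw [hxi, Pi.single_eq_same]
    refine ⟨?_, hxH⟩
    rw [← hh] at hx
    rw [abs_of_neg (by linarith)]
    linarith [neg_le_abs (x i0 - h)]
  · rintro x ⟨⟨hx, _⟩, hxH⟩
    refine ⟨?_, hxH⟩
    simp only [hC, hH, crossPolytope, Set.mem_setOf_eq, key, not_lt] at hx hxH ⊢
    have e : ∑ i ∈ Finset.univ.erase i0, |x i - (Pi.single i0 (h / 2) : Fin n → ℝ) i| = ∑ i ∈ Finset.univ.erase i0, |x i - (0 : Fin n → ℝ) i| := by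
      refine Finset.sum_congr rfl fun i hi => ?_
      have := Finset.ne_of_mem_erase hi
      simp [this]
    rw [e, Pi.single_eq_same, abs_of_nonneg (by linarith)]
    have := le_abs_self (x i0 - (0 : Fin n → ℝ) i0)
    simp only [Pi.zero_apply] at *
    linarith

theorem stmt11 (n : ℕ) (hn : 0 < n) (a : Fin n → ℤ)
    (hmono : ∀ i j : Fin n, i ≤ j → a j ≤ a i) (hnn : ∀ i, 0 ≤ a i)
    (ha1 : 1 ≤ a ⟨0, hn⟩)
    (ε c₂ : ℝ) (hε0 : 0 < ε) (hε1 : ε < 1) (hc₂0 : 0 < c₂) (hc₂ε : c₂ * ε < 1)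
    (β : ℝ) (hβ0 : 0 < β) (hβ1 : β < 1)
    (hβ : c₂ * ε / (n * ∑ i, |(a i : ℝ)|) ≤ 1 - β)
    (I : ℝ)
    (hI : I = (volume (crossPolytope (0 : Fin n → ℝ) 1 ∩
        crossPolytope ((1 - β) • fun i => (a i : ℝ)) β)).toReal)
    (Z : ℝ) (hZ1 : I ≤ Z) (hZ2 : Z ≤ (1 + c₂ * ε ^ 2 / (2 * n)) * I) :
    (1 - ε) * ((2 : ℝ) ^ n / (n.factorial : ℝ) - I)
      ≤ (2 : ℝ) ^ n / (n.factorial : ℝ) - Z ∧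
    (2 : ℝ) ^ n / (n.factorial : ℝ) - Z
      ≤ (2 : ℝ) ^ n / (n.factorial : ℝ) - I := by
  refine ⟨?_, by linarith⟩
  have hnR : (0:ℝ) < n := by exact_mod_cast hn
  have hn1 : (1:ℝ) ≤ n := by exact_mod_cast hn
  set i0 : Fin n := ⟨0, hn⟩ with hi0
  have ha1R : (1:ℝ) ≤ a i0 := by exact_mod_cast ha1
  set N := ∑ i, |(a i : ℝ)| with hN
  have hNle : N ≤ n * a i0 := by
    have : N ≤ ∑ i : Fin n, (a i0 : ℝ) := by
      refine Finset.sum_le_sum fun i _ => ?_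
      rw [abs_of_nonneg (by exact_mod_cast hnn i)]
      exact_mod_cast hmono i0 i (Fin.mk_le_of_le_val (Nat.zero_le _))
    simpa using this
  have hNpos : 1 ≤ N := by
    have := Finset.single_le_sum (f := fun i => |(a i : ℝ)|) (fun i _ => abs_nonneg _) (Finset.mem_univ i0)
    exact (ha1R.trans (le_abs_self _)).trans this
  set V : ℝ := (2 : ℝ) ^ n / (n.factorial : ℝ) with hV
  have hVpos : 0 < V := by positivity
  set h : ℝ := (1 - β) * a i0 with hh
  have hs : c₂ * ε / (2 * n) ≤ n * (h / 2) := by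
    rw [div_le_iff₀ (by positivity)] at hβ
    rw [div_le_iff₀ (by positivity)]
    have : (1 - β) * (n * N) ≤ (1 - β) * (n * (n * a i0)) := by
      have : 0 ≤ 1 - β := by linarith
      gcongr
    rw [hh]
    nlinarith
  have hh0 : 0 ≤ h := mul_nonneg (by linarith) (by linarith)
  have hIle : I ≤ (max (1 - h / 2) 0) ^ n * V := by
    have := vol_inter i0 ((1 - β) • fun i => (a i : ℝ)) β hβ1.le
    rw [vol_cp hn] at this
    have h3 := ENNReal.toReal_mono (by finiteness) this
    rw [← hI] at h3
    rw [ENNReal.toReal_mul, ENNReal.toReal_pow, ENNReal.toReal_ofReal', ENNReal.toReal_ofReal hVpos.le] at h3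
    simpa [hh] using h3
  have hI0 : 0 ≤ I := hI ▸ ENNReal.toReal_nonneg
  have hmain : I * (1 + n * (h / 2)) ≤ V := by
    rcases le_or_gt (1 - h / 2) 0 with hc | hc
    · rw [max_eq_right hc, zero_pow hn.ne', zero_mul] at hIle
      have : I = 0 := le_antisymm hIle hI0
      rw [this]; linarith
    · rw [max_eq_left hc.le] at hIle
      have b := one_add_mul_le_pow (a := h / 2) (by linarith) n
      calc I * (1 + n * (h / 2)) ≤ ((1 - h / 2) ^ n * V) * (1 + h / 2) ^ n := by gcongr
        _ = ((1 - h / 2) * (1 + h / 2)) ^ n * V := by rw [mul_pow]; ring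
        _ ≤ 1 * V := by
          gcongr
          exact pow_le_one₀ (by positivity) (by nlinarith)
        _ = V := one_mul _
  have h4 : I * (c₂ * ε / (2 * n)) ≤ V - I := by nlinarith [mul_le_mul_of_nonneg_left hs hI0]
  have h5 : (1 + c₂ * ε ^ 2 / (2 * n)) * I = I + ε * (I * (c₂ * ε / (2 * n))) := by ring
  nlinarith [mul_le_mul_of_nonneg_left h4 hε0.le]
end

section
/- Let n ≥ 1 and let a ∈ ℤⁿ satisfy a_1 ≥ a_2 ≥ ⋯ ≥ a_n ≥ 0 and a_1 ≥ 1. Let 0 < ε ≤ 1/2, let c be a real number with 1/4 ≤ c ≤ 1/2, and let β be defined by 1 − β = c·ε/(n·‖a‖₁). If a real number Z satisfies Vol(Q_0 ∩ Q_1) ≤ Z ≤ (1 + c·ε²/(2n))·Vol(Q_0 ∩ Q_1), then V̂ := ((1+ε)/(1−βⁿ))·(2ⁿ/n! − Z) satisfies (1−ε)·Vol(P_a) ≤ V̂ ≤ (1+ε)·Vol(P_a). -/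
open MeasureTheory

namespace KD

/-- sign of a Boolean -/
def sg (b : Bool) : ℝ := if b then 1 else -1

theorem sg_abs (b : Bool) : |sg b| = 1 := by cases b <;> simp [sg]
theorem sg_sq (b : Bool) : sg b * sg b = 1 := by cases b <;> simp [sg]
theorem sg_not (b : Bool) : sg (!b) = - sg b := by cases b <;> simp [sg]
theorem sg_mul_le (b : Bool) (x : ℝ) : sg b * x ≤ |x| := by
  cases b <;> simp [sg, le_abs_self, neg_le_abs]

theorem exists_sg (x : ℝ) : ∃ b, sg b * x = |x| := by
  rcases le_total 0 x with h | h
  · exact ⟨true, by simp [sg, abs_of_nonneg h]⟩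
  · exact ⟨false, by simp [sg, abs_of_nonpos h]⟩

/-- signed sum -/
def w {n : ℕ} (σ : Fin n → Bool) (x : Fin n → ℝ) : ℝ := ∑ i, sg (σ i) * x i

theorem w_le {n : ℕ} (σ : Fin n → Bool) (x : Fin n → ℝ) : w σ x ≤ ∑ i, |x i| :=
  Finset.sum_le_sum fun i _ => sg_mul_le _ _

theorem exists_w {n : ℕ} (x : Fin n → ℝ) : ∃ σ : Fin n → Bool, w σ x = ∑ i, |x i| := by
  choose σ hσ using fun i => exists_sg (x i)
  exact ⟨σ, Finset.sum_congr rfl fun i _ => hσ i⟩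

theorem w_add {n : ℕ} (σ : Fin n → Bool) (x y : Fin n → ℝ) : w σ (x + y) = w σ x + w σ y := by
  simp [w, mul_add, Finset.sum_add_distrib]
theorem w_smul {n : ℕ} (σ : Fin n → Bool) (t : ℝ) (x : Fin n → ℝ) : w σ (t • x) = t * w σ x := by
  simp only [w, Finset.mul_sum, Pi.smul_apply, smul_eq_mul]
  exact Finset.sum_congr rfl fun i _ => by ring
theorem w_sub {n : ℕ} (σ : Fin n → Bool) (x y : Fin n → ℝ) : w σ (x - y) = w σ x - w σ y := by
  simp [w, mul_sub, Finset.sum_sub_distrib]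

/-- `w σ` as a linear functional -/
def wl {n : ℕ} (σ : Fin n → Bool) : (Fin n → ℝ) →ₗ[ℝ] ℝ where
  toFun := w σ
  map_add' := w_add σ
  map_smul' t x := by simp [w_smul]

theorem w_cont {n : ℕ} (σ : Fin n → Bool) : Continuous (w σ) := by
  unfold w; fun_prop

/-- open orthant simplex -/
def Op {n : ℕ} (σ : Fin n → Bool) (r : ℝ) : Set (Fin n → ℝ) :=
  {x | (∀ i, 0 < sg (σ i) * x i) ∧ w σ x ≤ r}
/-- closed orthant simplex -/
def Cl {n : ℕ} (σ : Fin n → Bool) (r : ℝ) : Set (Fin n → ℝ) :=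
  {x | (∀ i, 0 ≤ sg (σ i) * x i) ∧ w σ x ≤ r}

theorem measurable_Op {n : ℕ} (σ : Fin n → Bool) (r : ℝ) : MeasurableSet (Op σ r) := by
  have h1 : MeasurableSet {x : Fin n → ℝ | ∀ i, 0 < sg (σ i) * x i} := by
    rw [Set.ofPred_forall]
    exact MeasurableSet.iInter fun i => (isOpen_lt continuous_const (by fun_prop)).measurableSet
  exact h1.inter (isClosed_le (w_cont σ) continuous_const).measurableSet

theorem measurable_cross {n : ℕ} (c : Fin n → ℝ) (r : ℝ) : MeasurableSet (crossPolytope c r) :=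
  (isClosed_le (by fun_prop) continuous_const).measurableSet

theorem w_eq_of_nonneg {n : ℕ} {σ : Fin n → Bool} {x : Fin n → ℝ}
    (h : ∀ i, 0 ≤ sg (σ i) * x i) : w σ x = ∑ i, |x i| :=
  Finset.sum_congr rfl fun i _ => by
    rw [← abs_of_nonneg (h i), abs_mul, sg_abs, one_mul]

theorem vol_cross {n : ℕ} (hn : 0 < n) (r : ℝ) :
    volume (crossPolytope (0 : Fin n → ℝ) r) =
      ENNReal.ofReal r ^ n * ENNReal.ofReal (2 ^ n / (n.factorial : ℝ)) := by
  have : Nonempty (Fin n) := ⟨⟨0, hn⟩⟩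
  have h := MeasureTheory.volume_sum_rpow_le (ι := Fin n) (p := 1) le_rfl r
  have e : Real.Gamma (1 / 1 + 1) = 1 := by
    rw [show (1 : ℝ) / 1 + 1 = 2 by norm_num]; exact Real.Gamma_two
  have e2 : Real.Gamma ((n : ℝ) / 1 + 1) = n.factorial := by
    rw [div_one]; exact Real.Gamma_nat_eq_factorial n
  rw [Fintype.card_fin, e, e2, mul_one] at h
  rw [← h]
  congr 1
  ext x
  simp [crossPolytope]

theorem vol_cross_real {n : ℕ} (hn : 0 < n) {r : ℝ} (hr : 0 ≤ r) :
    volume.real (crossPolytope (0 : Fin n → ℝ) r) = r ^ n * (2 ^ n / (n.factorial : ℝ)) := by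
  rw [measureReal_def, vol_cross hn, ENNReal.toReal_mul, ENNReal.toReal_pow,
    ENNReal.toReal_ofReal hr, ENNReal.toReal_ofReal (by positivity)]

theorem vol_cross_ne_top {n : ℕ} (hn : 0 < n) (r : ℝ) :
    volume (crossPolytope (0 : Fin n → ℝ) r) ≠ ⊤ := by
  rw [vol_cross hn]
  exact ENNReal.mul_ne_top (ENNReal.pow_ne_top ENNReal.ofReal_ne_top) ENNReal.ofReal_ne_top

theorem Op_sub_cross {n : ℕ} (σ : Fin n → Bool) (r : ℝ) : Op σ r ⊆ crossPolytope 0 r := by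
  intro x hx
  have := w_eq_of_nonneg fun i => (hx.1 i).le
  simp only [crossPolytope, Set.mem_ofPred_eq, Pi.zero_apply, sub_zero]
  rw [← this]; exact hx.2

theorem Op_ne_top {n : ℕ} (hn : 0 < n) (σ : Fin n → Bool) (r : ℝ) : volume (Op σ r) ≠ ⊤ :=
  ne_top_of_le_ne_top (vol_cross_ne_top hn r) (measure_mono (Op_sub_cross σ r))

theorem refl_mp {n : ℕ} (σ : Fin n → Bool) :
    MeasurePreserving (fun (x : Fin n → ℝ) i => sg (σ i) * x i) volume volume := by
  refine volume_preserving_pi (f := fun i (y : ℝ) => sg (σ i) * y) fun i => ?_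
  cases h : σ i
  · simpa [sg] using Measure.measurePreserving_neg (volume : Measure ℝ)
  · simp only [sg, if_true, one_mul]; exact MeasurePreserving.id (volume : Measure ℝ)

theorem vol_Op_eq {n : ℕ} (σ : Fin n → Bool) (r : ℝ) :
    volume (Op σ r) = volume (Op (fun _ : Fin n => true) r) := by
  rw [← (refl_mp σ).measure_preimage (measurable_Op _ r).nullMeasurableSet]
  congr 1
  ext x
  simp [Op, w, ← mul_assoc, sg_sq, show sg true = 1 from rfl]

theorem null_coord {n : ℕ} : volume {x : Fin n → ℝ | ∃ i, x i = 0} = 0 := by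
  rw [Set.ofPred_exists]
  refine measure_iUnion_null fun i => ?_
  rw [volume_pi]
  exact Measure.pi_hyperplane _ i 0

theorem Op_disj {n : ℕ} (r : ℝ) (σ τ : Fin n → Bool) (h : σ ≠ τ) : Disjoint (Op σ r) (Op τ r) := by
  rw [Set.disjoint_left]
  intro x hx hy
  obtain ⟨i, hi⟩ := Function.ne_iff.1 h
  have h1 := hx.1 i
  have h2 := hy.1 i
  cases h3 : σ i <;> cases h4 : τ i <;> simp_all [sg] <;> linarith

theorem vol_Op {n : ℕ} (hn : 0 < n) (σ : Fin n → Bool) {r : ℝ} (hr : 0 ≤ r) :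
    volume.real (Op σ r) = r ^ n / n.factorial := by
  have h1 : volume.real (⋃ σ : Fin n → Bool, Op σ r) = ∑ σ : Fin n → Bool, volume.real (Op σ r) :=
    measureReal_iUnion_fintype (fun σ τ h => Op_disj r σ τ h) (fun σ => measurable_Op σ r)
      (fun σ => Op_ne_top hn σ r)
  have h2 : volume (⋃ σ : Fin n → Bool, Op σ r) = volume (crossPolytope (0 : Fin n → ℝ) r) := by
    apply le_antisymm (measure_mono (Set.iUnion_subset fun σ => Op_sub_cross σ r))
    rw [← measure_sdiff_null (s := crossPolytope (0 : Fin n → ℝ) r) (null_coord (n := n))]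
    apply measure_mono
    rintro x ⟨hx, hx0⟩
    simp only [Set.mem_ofPred_eq, not_exists] at hx0
    obtain ⟨σ, hσ⟩ : ∃ σ : Fin n → Bool, ∀ i, sg (σ i) * x i = |x i| := by
      choose σ hσ using fun i => exists_sg (x i)
      exact ⟨σ, hσ⟩
    refine Set.mem_iUnion.2 ⟨σ, fun i => ?_, ?_⟩
    · rw [hσ]; exact abs_pos.2 (hx0 i)
    · simp only [w, hσ]; simpa [crossPolytope] using hx
  have h3 : ∀ τ : Fin n → Bool, volume.real (Op τ r) = volume.real (Op σ r) := fun τ => by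
    rw [measureReal_def, measureReal_def, vol_Op_eq, vol_Op_eq σ]
  rw [measureReal_def, h2, ← measureReal_def, vol_cross_real hn hr] at h1
  simp only [h3] at h1
  simp at h1
  have : (2 : ℝ) ^ n ≠ 0 := by positivity
  field_simp at h1 ⊢
  linarith

theorem vol_Cl {n : ℕ} (σ : Fin n → Bool) (r : ℝ) :
    volume (Cl σ r) = volume (Op σ r) := by
  apply le_antisymm
  · rw [← measure_sdiff_null (s := Cl σ r) (null_coord (n := n))]
    apply measure_mono
    rintro x ⟨hx, hx0⟩
    simp only [Set.mem_ofPred_eq, not_exists] at hx0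
    refine ⟨fun i => lt_of_le_of_ne (hx.1 i) (Ne.symm (mul_ne_zero ?_ (hx0 i))), hx.2⟩
    intro h; have := sg_abs (σ i); rw [h] at this; simp at this
  · exact measure_mono fun x hx => ⟨fun i => (hx.1 i).le, hx.2⟩


/-- union of shrunk cross-polytopes -/
def R {n : ℕ} (a : Fin n → ℝ) : Set (Fin n → ℝ) :=
  {x | ∃ s : ℝ, 0 ≤ s ∧ s ≤ 1 ∧ ∑ i, |x i - s * a i| ≤ 1 - s}

theorem R_convex {n : ℕ} (a : Fin n → ℝ) : Convex ℝ (R a) := by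
  rintro x ⟨s, hs0, hs1, hs⟩ y ⟨t, ht0, ht1, ht⟩ p q hp hq hpq
  refine ⟨p * s + q * t, by positivity, by nlinarith, ?_⟩
  calc ∑ i, |(p • x + q • y) i - (p * s + q * t) * a i|
      ≤ ∑ i, (p * |x i - s * a i| + q * |y i - t * a i|) := by
        apply Finset.sum_le_sum
        intro i _
        have : (p • x + q • y) i - (p * s + q * t) * a i
            = p * (x i - s * a i) + q * (y i - t * a i) := by
          simp only [Pi.add_apply, Pi.smul_apply, smul_eq_mul]; ring
        rw [this]
        refine (abs_add_le _ _).trans (le_of_eq ?_)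
        rw [abs_mul, abs_mul, abs_of_nonneg hp, abs_of_nonneg hq]
    _ = p * ∑ i, |x i - s * a i| + q * ∑ i, |y i - t * a i| := by
        rw [Finset.sum_add_distrib, Finset.mul_sum, Finset.mul_sum]
    _ ≤ p * (1 - s) + q * (1 - t) := by gcongr
    _ = 1 - (p * s + q * t) := by linear_combination hpq

theorem sum_abs_single {n : ℕ} (i : Fin n) : ∑ j, |(Pi.single i (1 : ℝ) : Fin n → ℝ) j| = 1 := by
  rw [Finset.sum_eq_single i]
  · simp
  · intro j _ h; simp [h]
  · simp

theorem kd_sub_R {n : ℕ} (a : Fin n → ℝ) : knapsackDual a ⊆ R a := by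
  apply convexHull_min _ (R_convex a)
  apply Set.union_subset
  · rintro x rfl
    exact ⟨1, by norm_num, by norm_num, by simp⟩
  · apply Set.iUnion_subset
    intro i x hx
    refine ⟨0, by norm_num, by norm_num, ?_⟩
    rcases hx with rfl | hx
    · simp [sum_abs_single]
    · rw [Set.mem_singleton_iff] at hx
      subst hx
      simp [sum_abs_single]

theorem cross_sub_kd {n : ℕ} (hn : 0 < n) (a : Fin n → ℝ) :
    crossPolytope (0 : Fin n → ℝ) 1 ⊆ knapsackDual a := by
  intro x hx
  have hx' : ∑ i, |x i| ≤ 1 := by simpa [crossPolytope] using hx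
  have hc : Convex ℝ (knapsackDual a) := convex_convexHull ℝ _
  have h1 : ∀ i, (Pi.single i (1 : ℝ) : Fin n → ℝ) ∈ knapsackDual a := fun i =>
    subset_convexHull ℝ _ (Or.inr (Set.mem_iUnion.2 ⟨i, Or.inl rfl⟩))
  have h2 : ∀ i, -(Pi.single i (1 : ℝ) : Fin n → ℝ) ∈ knapsackDual a := fun i =>
    subset_convexHull ℝ _ (Or.inr (Set.mem_iUnion.2 ⟨i, Or.inr rfl⟩))
  have h0 : (0 : Fin n → ℝ) ∈ knapsackDual a := by
    have := hc (h1 ⟨0, hn⟩) (h2 ⟨0, hn⟩) (a := 1 / 2) (b := 1 / 2) (by norm_num) (by norm_num)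
      (by norm_num)
    simpa using this
  have h3 : ∀ i, ∃ z ∈ knapsackDual a, |x i| • z = Pi.single i (x i) := by
    intro i
    rcases le_total 0 (x i) with h | h
    · refine ⟨_, h1 i, ?_⟩
      rw [abs_of_nonneg h, ← Pi.single_smul]; simp
    · refine ⟨_, h2 i, ?_⟩
      rw [abs_of_nonpos h, smul_neg, neg_smul, neg_neg, ← Pi.single_smul]; simp
  choose z hz hzx using h3
  have := hc.sum_mem (t := Finset.univ) (w := fun o : Option (Fin n) => o.elim (1 - ∑ i, |x i|) (fun i => |x i|))
    (z := fun o => o.elim 0 z) ?_ ?_ ?_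
  · rw [Fintype.sum_option] at this
    simp only [Option.elim_none, Option.elim_some, smul_zero, zero_add, hzx] at this
    rwa [Finset.univ_sum_single] at this
  · rintro (_ | i) _
    · simpa using hx'
    · simp
  · rw [Fintype.sum_option]; simp
  · rintro (_ | i) _
    · simpa using h0
    · simpa using hz i

theorem kd_compact {n : ℕ} (a : Fin n → ℝ) : IsCompact (knapsackDual a) := by
  apply Set.Finite.isCompact_convexHull
  exact (Set.finite_singleton a).union (Set.finite_iUnion fun i => Set.toFinite _)

theorem kd_upper {n : ℕ} (hn : 0 < n) (a : Fin n → ℝ) (β : ℝ) (hβ0 : 0 ≤ β) (hβ1 : β < 1) :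
    volume.real (crossPolytope (0 : Fin n → ℝ) 1 \ crossPolytope ((1 - β) • a) β)
      ≤ (1 - β ^ n) * volume.real (knapsackDual a) := by
  set P := knapsackDual a with hP
  have hPtop : volume P ≠ ⊤ := (kd_compact a).measure_lt_top.ne
  have haP : a ∈ P := subset_convexHull ℝ _ (Or.inl rfl)
  set H := AffineMap.homothety a β '' P with hH
  have hHc : IsCompact H := (kd_compact a).image (AffineMap.homothety_continuous a β)
  have hHP : H ⊆ P := by
    rintro _ ⟨x, hx, rfl⟩
    have := (convex_convexHull ℝ _ : Convex ℝ P) hx haP hβ0 (sub_nonneg.2 hβ1.le) (by ring)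
    convert! this using 1
    rw [AffineMap.homothety_apply]
    simp only [vsub_eq_sub, vadd_eq_add]
    module
  have hvol : volume.real H = β ^ n * volume.real P := by
    rw [measureReal_def, hH, Measure.addHaar_image_homothety, ENNReal.toReal_mul,
      ENNReal.toReal_ofReal (abs_nonneg _), Module.finrank_fin_fun, abs_of_nonneg (by positivity)]
    rfl
  have hsub : crossPolytope (0 : Fin n → ℝ) 1 \ crossPolytope ((1 - β) • a) β ⊆ P \ H := by
    rintro x ⟨hx, hx1⟩
    refine ⟨cross_sub_kd hn a hx, ?_⟩
    rintro ⟨y, hy, rfl⟩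
    apply hx1
    obtain ⟨s, hs0, hs1, hs⟩ := kd_sub_R a hy
    have hx' : ∑ i, |(AffineMap.homothety a β y) i| ≤ 1 := by
      simpa only [crossPolytope, Set.mem_ofPred_eq, Pi.zero_apply, sub_zero] using hx
    set x := AffineMap.homothety a β y with hxdef
    have hxi : ∀ i, x i = β * (y i - a i) + a i := fun i => by
      rw [hxdef, AffineMap.homothety_apply]; simp
    have hs'pos : 0 < 1 - β + β * s := by nlinarith
    set s' := 1 - β + β * s with hs'
    set p := (1 - β) / s' with hp
    have hp0 : 0 ≤ p := div_nonneg (by linarith) hs'pos.le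
    have hp1 : p ≤ 1 := by rw [hp, div_le_one hs'pos]; nlinarith
    have hps : p * s' = 1 - β := by rw [hp]; field_simp
    show ∑ i, |x i - ((1 - β) • a) i| ≤ β
    calc ∑ i, |x i - ((1 - β) • a) i|
        ≤ ∑ i, ((1 - p) * |x i| + p * (β * |y i - s * a i|)) := by
          apply Finset.sum_le_sum
          intro i _
          have e : x i - ((1 - β) • a) i = (1 - p) * x i + p * (β * (y i - s * a i)) := by
            simp only [Pi.smul_apply, smul_eq_mul]
            have e1 : β * (y i - s * a i) = x i - s' * a i := by rw [hxi, hs']; ring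
            rw [e1, ← hps]; ring
          rw [e]
          refine (abs_add_le _ _).trans (le_of_eq ?_)
          rw [abs_mul, abs_mul, abs_mul, abs_of_nonneg hp0, abs_of_nonneg hβ0,
            abs_of_nonneg (sub_nonneg.2 hp1)]
      _ = (1 - p) * ∑ i, |x i| + p * (β * ∑ i, |y i - s * a i|) := by
          rw [Finset.sum_add_distrib, Finset.mul_sum, Finset.mul_sum, Finset.mul_sum]
      _ ≤ (1 - p) * 1 + p * (β * (1 - s)) := by
          have := sub_nonneg.2 hp1
          gcongr
      _ = β := by
          have : β * (1 - s) = 1 - s' := by rw [hs']; ring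
          rw [this]; linear_combination - hps
  calc _ ≤ volume.real (P \ H) := measureReal_mono hsub
          (ne_top_of_le_ne_top hPtop (measure_mono Set.sdiff_subset))
    _ = volume.real P - volume.real H := by
        rw [measureReal_def, measure_sdiff hHP hHc.measurableSet.nullMeasurableSet
          hHc.measure_lt_top.ne, ENNReal.toReal_sub_of_le (measure_mono hHP) hPtop]
        rfl
    _ = _ := by rw [hvol]; ring

theorem kd_cover {n : ℕ} (a : Fin n → ℝ) (ha : ∀ i, 0 ≤ a i) :
    knapsackDual a ⊆ ⋃ σ ∈ Finset.univ.filter (fun σ : Fin n → Bool => w σ a < 1),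
      (fun y => a + y) '' (LinearMap.transvection (wl σ) (-a) '' Cl σ 1) := by
  intro x hx
  obtain ⟨s, hs0, hs1, hs⟩ := kd_sub_R a hx
  have hsσ : ∀ σ : Fin n → Bool, s * (1 - w σ a) ≤ 1 - w σ x := by
    intro σ
    have h := w_le σ (x - s • a)
    rw [w_sub, w_smul] at h
    simp only [Pi.sub_apply, Pi.smul_apply, smul_eq_mul] at h
    linarith
  have hne : (Finset.univ.filter (fun σ : Fin n → Bool => w σ a < 1)).Nonempty := by
    refine ⟨fun _ => false, ?_⟩
    simp only [Finset.mem_filter, Finset.mem_univ, true_and]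
    have : w (fun _ => false) a = - ∑ i, a i := by simp [w, sg]
    rw [this]
    have := Finset.sum_nonneg (s := Finset.univ) fun i _ => ha i
    linarith
  obtain ⟨τ, hτ, hmin⟩ := Finset.exists_min_image _ (fun σ => (1 - w σ x) / (1 - w σ a)) hne
  simp only [Finset.mem_filter, Finset.mem_univ, true_and] at hτ hmin
  have hτ' : 0 < 1 - w τ a := by linarith
  set q := (1 - w τ x) / (1 - w τ a) with hq
  have hqe : q * (1 - w τ a) = 1 - w τ x := by rw [hq]; field_simp
  have hsq : s ≤ q := by rw [hq, le_div_iff₀ hτ']; exact hsσ τ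
  have hqσ : ∀ σ : Fin n → Bool, q * (1 - w σ a) ≤ 1 - w σ x := by
    intro σ
    rcases lt_or_ge (w σ a) 1 with h | h
    · have := hmin σ h
      rwa [le_div_iff₀ (by linarith)] at this
    · have := hsσ σ
      nlinarith
  have hnorm : ∑ i, |(x - q • a) i| ≤ 1 - q := by
    obtain ⟨σ, hσ⟩ := exists_w (x - q • a)
    rw [← hσ, w_sub, w_smul]
    linarith [hqσ σ]
  have hwτ : w τ (x - q • a) = 1 - q := by
    rw [w_sub, w_smul]; linarith
  have heq : ∀ i ∈ Finset.univ, sg (τ i) * (x - q • a) i = |(x - q • a) i| := by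
    apply (Finset.sum_eq_sum_iff_of_le fun i _ => sg_mul_le _ _).1
    apply le_antisymm (w_le τ _)
    exact hnorm.trans hwτ.ge
  simp only [Set.mem_iUnion]
  refine ⟨τ, by simpa using hτ, _, ⟨x - q • a, ⟨fun i => ?_, ?_⟩, rfl⟩, ?_⟩
  · rw [heq i (Finset.mem_univ i)]; exact abs_nonneg _
  · rw [hwτ]; linarith
  · rw [LinearMap.transvection.apply, show wl τ (x - q • a) = w τ (x - q • a) from rfl, hwτ]
    module

theorem kd_vol_le {n : ℕ} (hn : 0 < n) (a : Fin n → ℝ) (ha : ∀ i, 0 ≤ a i) :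
    volume.real (knapsackDual a) ≤
      ∑ σ ∈ Finset.univ.filter (fun σ : Fin n → Bool => w σ a < 1),
        (1 - w σ a) / n.factorial := by
  have hv : ∀ σ : Fin n → Bool, w σ a < 1 →
      volume ((fun y => a + y) '' (LinearMap.transvection (wl σ) (-a) '' Cl σ 1)) =
        ENNReal.ofReal (1 - w σ a) * volume (Op σ 1) := by
    intro σ h
    rw [Set.image_add_left, measure_preimage_add, Measure.addHaar_image_linearMap,
      LinearMap.transvection.det, vol_Cl, map_neg, show wl σ a = w σ a from rfl, ← sub_eq_add_neg,
      abs_of_pos (by linarith)]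
  have htop : ∀ σ : Fin n → Bool, w σ a < 1 →
      volume ((fun y => a + y) '' (LinearMap.transvection (wl σ) (-a) '' Cl σ 1)) ≠ ⊤ := by
    intro σ h
    rw [hv σ h]
    exact ENNReal.mul_ne_top ENNReal.ofReal_ne_top (Op_ne_top hn σ 1)
  refine (measureReal_mono (kd_cover a ha) ?_).trans ?_
  · refine (measure_biUnion_lt_top (Finset.finite_toSet _) fun σ hσ => ?_).ne
    exact (htop σ (by simpa using hσ)).lt_top
  refine (measureReal_biUnion_finset_le _ _).trans (Finset.sum_le_sum fun σ hσ => ?_)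
  have h : w σ a < 1 := by simpa using hσ
  rw [measureReal_def, hv σ h, ENNReal.toReal_mul, ENNReal.toReal_ofReal (by linarith),
    ← measureReal_def, vol_Op hn σ zero_le_one, one_pow, mul_one_div]

theorem lower_W {n : ℕ} (hn : 0 < n) (a : Fin n → ℝ) (β : ℝ)
    (hu : ∀ σ : Fin n → Bool, (1 - β) * (1 - w σ a) ≤ 1) (hβ1 : β < 1) :
    ∑ σ ∈ Finset.univ.filter (fun σ : Fin n → Bool => w σ a < 1),
        (1 - (1 - (1 - β) * (1 - w σ a)) ^ n) / n.factorial ≤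
    volume.real (crossPolytope (0 : Fin n → ℝ) 1 \ crossPolytope ((1 - β) • a) β) := by
  set r : (Fin n → Bool) → ℝ := fun σ => 1 - (1 - β) * (1 - w σ a) with hr
  have hdisj : (↑(Finset.univ.filter (fun σ : Fin n → Bool => w σ a < 1)) : Set (Fin n → Bool)).PairwiseDisjoint
      (fun σ => Op σ 1 \ Op σ (r σ)) := fun σ _ τ _ h =>
    (Op_disj 1 σ τ h).mono Set.sdiff_subset Set.sdiff_subset
  have hmeas : ∀ σ ∈ Finset.univ.filter (fun σ : Fin n → Bool => w σ a < 1),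
      MeasurableSet (Op σ 1 \ Op σ (r σ)) := fun σ _ => (measurable_Op σ 1).diff (measurable_Op σ _)
  have hfin : ∀ σ ∈ Finset.univ.filter (fun σ : Fin n → Bool => w σ a < 1),
      volume (Op σ 1 \ Op σ (r σ)) ≠ ⊤ := fun σ _ =>
    ne_top_of_le_ne_top (Op_ne_top hn σ 1) (measure_mono Set.sdiff_subset)
  have hsum := measureReal_biUnion_finset (μ := volume) hdisj hmeas hfin
  have hval : ∀ σ ∈ Finset.univ.filter (fun σ : Fin n → Bool => w σ a < 1),
      volume.real (Op σ 1 \ Op σ (r σ)) = (1 - (r σ) ^ n) / n.factorial := by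
    intro σ hσ
    have h : w σ a < 1 := by simpa using hσ
    have hr0 : 0 ≤ r σ := by have := hu σ; simp only [hr]; linarith
    have hr1 : r σ ≤ 1 := by simp only [hr]; nlinarith
    have hss : Op σ (r σ) ⊆ Op σ 1 := fun x hx => ⟨hx.1, hx.2.trans hr1⟩
    rw [measureReal_def, measure_sdiff hss (measurable_Op _ _).nullMeasurableSet (Op_ne_top hn _ _),
      ENNReal.toReal_sub_of_le (measure_mono hss) (Op_ne_top hn _ _), ← measureReal_def,
      ← measureReal_def, vol_Op hn σ hr0, vol_Op hn σ zero_le_one]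
    ring
  rw [Finset.sum_congr rfl hval] at hsum
  rw [← hsum]
  apply measureReal_mono
  · intro x hx
    simp only [Set.mem_iUnion] at hx
    obtain ⟨σ, hσ, hx1, hx2⟩ := hx
    refine ⟨Op_sub_cross σ 1 hx1, fun hx3 => hx2 ⟨hx1.1, ?_⟩⟩
    have h := (w_le σ (x - (1 - β) • a)).trans hx3
    rw [w_sub, w_smul] at h
    simp only [hr]; linarith
  · exact ne_top_of_le_ne_top (vol_cross_ne_top hn 1) (measure_mono Set.sdiff_subset)

theorem sum_sg_sg {n : ℕ} (i j : Fin n) (h : i ≠ j) :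
    ∑ σ : Fin n → Bool, sg (σ i) * sg (σ j) = 0 := by
  have hinv : Function.Involutive (fun σ : Fin n → Bool => Function.update σ j (!σ j)) := by
    intro σ; simp
  have := Equiv.sum_comp hinv.toPerm (fun σ : Fin n → Bool => sg (σ i) * sg (σ j))
  simp only [Function.Involutive.coe_toPerm, Function.update_self, Function.update_of_ne h, sg_not,
    mul_neg, Finset.sum_neg_distrib] at this
  linarith

theorem sum_sg {n : ℕ} (j : Fin n) : ∑ σ : Fin n → Bool, sg (σ j) = 0 := by
  have hinv : Function.Involutive (fun σ : Fin n → Bool => Function.update σ j (!σ j)) := by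
    intro σ; simp
  have := Equiv.sum_comp hinv.toPerm (fun σ : Fin n → Bool => sg (σ j))
  simp only [Function.Involutive.coe_toPerm, Function.update_self, sg_not,
    Finset.sum_neg_distrib] at this
  linarith

theorem sum_lower {n : ℕ} (a : Fin n → ℝ) (k : Fin n) :
    2 ^ n * ((1 + a k) / 2) ≤
      ∑ σ ∈ Finset.univ.filter (fun σ : Fin n → Bool => w σ a < 1), (1 - w σ a) := by
  have h1 : ∑ σ : Fin n → Bool, w σ a = 0 := by
    unfold w
    rw [Finset.sum_comm]
    simp [← Finset.sum_mul, sum_sg]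
  have h2 : ∑ σ : Fin n → Bool, sg (σ k) * w σ a = 2 ^ n * a k := by
    simp only [w, Finset.mul_sum, ← mul_assoc]
    rw [Finset.sum_comm, Finset.sum_eq_single k]
    · simp [sg_sq]
    · intro j _ hj
      rw [← Finset.sum_mul, sum_sg_sg k j hj.symm, zero_mul]
    · simp
  have h3 : ∑ σ : Fin n → Bool, (1 - sg (σ k)) / 2 * (1 - w σ a) = 2 ^ n * ((1 + a k) / 2) := by
    have : ∀ σ : Fin n → Bool, (1 - sg (σ k)) / 2 * (1 - w σ a) =
        (1 - w σ a - sg (σ k) + sg (σ k) * w σ a) / 2 := fun σ => by ring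
    simp only [this]
    rw [← Finset.sum_div, Finset.sum_add_distrib, Finset.sum_sub_distrib, Finset.sum_sub_distrib,
      h1, h2, sum_sg]
    simp
    ring
  rw [← h3, Finset.sum_filter]
  apply Finset.sum_le_sum
  intro σ _
  split_ifs with h
  · cases σ k <;> simp [sg]; linarith
  · cases σ k <;> simp [sg]; linarith

theorem pow_bound (n : ℕ) (u : ℝ) (h0 : 0 ≤ u) (h1 : u ≤ 1) :
    n * u - n * (n - 1) / 2 * u ^ 2 ≤ 1 - (1 - u) ^ n := by
  induction n with
  | zero => simp
  | succ k ih =>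
    have hb := one_add_mul_le_pow (a := -u) (by linarith) k
    have e : (1 - u) ^ k = (1 + -u) ^ k := by ring
    rw [← e] at hb
    rw [pow_succ (1 - u)]
    push_cast
    nlinarith [mul_le_mul_of_nonneg_right hb h0]


end KD

set_option maxHeartbeats 2000000

theorem stmt12 (n : ℕ) (hn : 0 < n) (a : Fin n → ℤ)
    (hmono : ∀ i j : Fin n, i ≤ j → a j ≤ a i) (hnn : ∀ i, 0 ≤ a i)
    (ha1 : 1 ≤ a ⟨0, hn⟩)
    (ε c : ℝ) (hε0 : 0 < ε) (hε1 : ε ≤ 1 / 2) (hc1 : 1 / 4 ≤ c) (hc2 : c ≤ 1 / 2)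
    (β : ℝ) (hβ : 1 - β = c * ε / (n * ∑ i, |(a i : ℝ)|))
    (Z : ℝ)
    (hZ1 : (volume (crossPolytope (0 : Fin n → ℝ) 1 ∩
        crossPolytope ((1 - β) • fun i => (a i : ℝ)) β)).toReal ≤ Z)
    (hZ2 : Z ≤ (1 + c * ε ^ 2 / (2 * n)) *
        (volume (crossPolytope (0 : Fin n → ℝ) 1 ∩
          crossPolytope ((1 - β) • fun i => (a i : ℝ)) β)).toReal) :
    (1 - ε) * (volume (knapsackDual (fun i => (a i : ℝ)))).toReal
      ≤ (1 + ε) / (1 - β ^ n) * ((2 : ℝ) ^ n / (n.factorial : ℝ) - Z) ∧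
    (1 + ε) / (1 - β ^ n) * ((2 : ℝ) ^ n / (n.factorial : ℝ) - Z)
      ≤ (1 + ε) * (volume (knapsackDual (fun i => (a i : ℝ)))).toReal := by
  have hn1 : (1 : ℝ) ≤ n := by exact_mod_cast hn
  set b : Fin n → ℝ := fun i => (a i : ℝ) with hb
  have hb0 : ∀ i, 0 ≤ b i := fun i => by simp only [hb]; exact_mod_cast hnn i
  have hL : ∑ i, |(a i : ℝ)| = ∑ i, |b i| := rfl
  rw [hL] at hβ
  set L := ∑ i, |b i| with hLdef
  set A := b ⟨0, hn⟩ with hA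
  have hA1 : 1 ≤ A := by simp only [hA, hb]; exact_mod_cast ha1
  have hAL : A ≤ L := (le_abs_self _).trans
    (Finset.single_le_sum (f := fun i => |b i|) (fun i _ => abs_nonneg _) (Finset.mem_univ _))
  have hLA : L ≤ n * A := by
    have : L ≤ ∑ _i : Fin n, A := by
      apply Finset.sum_le_sum
      intro i _
      rw [abs_of_nonneg (hb0 i)]
      simp only [hA, hb]
      exact_mod_cast hmono ⟨0, hn⟩ i (Nat.zero_le _)
    simpa using this
  have hL1 : 1 ≤ L := hA1.trans hAL
  have hnL : 0 < (n : ℝ) * L := by positivity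
  have htn : (1 - β) * (n * L) = c * ε := by rw [hβ]; field_simp
  have hc0 : 0 < c := by linarith
  have hcε : c * ε ≤ 1 / 4 := by nlinarith
  have hcε0 : 0 < c * ε := by positivity
  have ht0 : 0 < 1 - β := by rw [hβ]; positivity
  have htL : (1 - β) * L ≤ 1 / 4 := by nlinarith [mul_nonneg ht0.le (by linarith : (0 : ℝ) ≤ L)]
  have ht1 : 1 - β ≤ 1 / 4 := by nlinarith
  have hβ1 : β < 1 := by linarith
  have hβ0 : 0 ≤ β := by linarith
  have hwL : ∀ σ : Fin n → Bool, 1 - KD.w σ b ≤ 1 + L := by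
    intro σ
    have h := KD.w_le σ (-b)
    have e : KD.w σ (-b) = - KD.w σ b := by simp [KD.w]
    rw [e] at h
    simp only [Pi.neg_apply, abs_neg] at h
    linarith
  set S := ∑ σ ∈ Finset.univ.filter (fun σ : Fin n → Bool => KD.w σ b < 1),
    (1 - KD.w σ b) / (n.factorial : ℝ) with hS
  set V0 : ℝ := 2 ^ n / (n.factorial : ℝ) with hV0
  have hf : (0 : ℝ) < n.factorial := by exact_mod_cast n.factorial_pos
  have hV0pos : 0 < V0 := by positivity
  have hSV : V0 * ((1 + A) / 2) ≤ S := by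
    have h := KD.sum_lower b ⟨0, hn⟩
    rw [hS, ← Finset.sum_div, le_div_iff₀ hf, hV0]
    calc _ = 2 ^ n * ((1 + A) / 2) := by field_simp
      _ ≤ _ := h
  have hup := KD.kd_upper hn b β hβ0 hβ1
  have hPS := KD.kd_vol_le hn b hb0
  have hlow := KD.lower_W hn b β (fun σ => by nlinarith [hwL σ]) hβ1
  set W := volume.real (crossPolytope (0 : Fin n → ℝ) 1 \ crossPolytope ((1 - β) • b) β) with hW
  have hWI : (volume (crossPolytope (0 : Fin n → ℝ) 1 ∩ crossPolytope ((1 - β) • b) β)).toReal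
      = V0 - W := by
    have h := measureReal_inter_add_sdiff (μ := volume) (s := crossPolytope (0 : Fin n → ℝ) 1)
      (KD.measurable_cross ((1 - β) • b) β) (KD.vol_cross_ne_top hn 1)
    rw [KD.vol_cross_real hn zero_le_one, one_pow, one_mul] at h
    rw [← measureReal_def]
    linarith
  rw [hWI] at hZ1 hZ2
  rw [← measureReal_def]
  set VP := volume.real (knapsackDual b) with hVP
  have hVP0 : 0 ≤ VP := measureReal_nonneg
  have hW0 : 0 ≤ W := measureReal_nonneg
  have hS0 : 0 ≤ S := hVP0.trans hPS
  -- Bernoulli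
  have hbern : 1 - β ^ n ≤ n * (1 - β) := by
    have := one_add_mul_le_pow (a := -(1 - β)) (by linarith) n
    have e : 1 + -(1 - β) = β := by ring
    rw [e] at this
    linarith
  have hpos : 0 < 1 - β ^ n := by
    have := pow_lt_one₀ hβ0 hβ1 hn.ne'
    linarith
  set T := n * (1 - β) * S with hT
  have hT0 : 0 ≤ T := by positivity
  have hPT : (1 - β ^ n) * VP ≤ T :=
    mul_le_mul hbern hPS hVP0 (by positivity)
  set l := n * (1 - β) * (1 + L) / 2 with hl
  have hWT : (1 - l) * T ≤ W := by
    refine le_trans ?_ hlow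
    rw [hT, hS, Finset.mul_sum, Finset.mul_sum]
    apply Finset.sum_le_sum
    intro σ hσ
    have hσ' : KD.w σ b < 1 := by simpa using hσ
    have hu0 : 0 ≤ (1 - β) * (1 - KD.w σ b) := mul_nonneg ht0.le (by linarith)
    have hu1 : (1 - β) * (1 - KD.w σ b) ≤ (1 - β) * (1 + L) :=
      mul_le_mul_of_nonneg_left (hwL σ) ht0.le
    have hp := KD.pow_bound n _ hu0 (by nlinarith)
    rw [le_div_iff₀ hf]
    refine le_trans (b := (1 - l) * (n * ((1 - β) * (1 - KD.w σ b))))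
      (le_of_eq ?_) (le_trans ?_ hp)
    · field_simp
    · set u := (1 - β) * (1 - KD.w σ b) with hu
      have h1 : (n - 1) * u ≤ n * ((1 - β) * (1 + L)) := by
        apply mul_le_mul (by linarith) hu1 hu0 (by linarith)
      have h2 : (n - 1) * u / 2 ≤ l := by rw [hl]; linarith
      have h3 : 0 ≤ n * u := by positivity
      have h4 := mul_le_mul_of_nonneg_right h2 h3
      linarith
  set r := A / (1 + A) with hr
  have hA0 : 0 < 1 + A := by linarith
  have hrA : r * (1 + A) = A := by rw [hr]; field_simp
  have hr1 : 1 / 2 ≤ r := by rw [hr, le_div_iff₀ hA0]; linarith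
  have hr2 : r ≤ 1 := by rw [hr, div_le_one hA0]; linarith
  have hlr : l * r ≤ ε / 4 := by
    have h1 : l * r * L = (c * ε) * ((1 + L) * r) / 2 := by rw [hl, ← htn]; ring
    have h2 : (1 + L) * r ≤ L := by
      rw [hr, mul_div_assoc', div_le_iff₀ hA0]; nlinarith
    have h3 : l * r * L ≤ (ε / 4) * L := by
      rw [h1]
      have h4 : c * ε * ((1 + L) * r) ≤ (1 / 2 * ε) * L :=
        mul_le_mul (mul_le_mul_of_nonneg_right hc2 hε0.le) h2 (by positivity) (by positivity)
      linarith
    exact le_of_mul_le_mul_right h3 (by linarith)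
  have hk : l + ε * r ≤ 5 / 4 * ε := by
    have h : (l + ε * r) * r ≤ (5 / 4 * ε) * r := by
      have : 0 ≤ (1 - r) * (r - 1 / 4) := mul_nonneg (by linarith) (by linarith)
      have h' := mul_nonneg hε0.le this
      linarith
    exact le_of_mul_le_mul_right h (by linarith)
  have hδ : c * ε ^ 2 / (2 * n) * V0 ≤ ε * r * T := by
    have h1 : n * (1 - β) * (V0 * ((1 + A) / 2)) ≤ T :=
      mul_le_mul_of_nonneg_left hSV (by positivity)
    have h2 : ε * r * (n * (1 - β) * (V0 * ((1 + A) / 2))) ≤ ε * r * T :=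
      mul_le_mul_of_nonneg_left h1 (by positivity)
    refine le_trans ?_ h2
    have h3 : ε * r * (n * (1 - β) * (V0 * ((1 + A) / 2))) = ε * V0 / 2 * (n * (1 - β) * A) := by
      linear_combination (ε * n * (1 - β) * V0 / 2) * hrA
    have h4 : c * ε / n ≤ n * (1 - β) * A := by
      rw [div_le_iff₀ (by linarith), ← htn]
      have : (1 - β) * n * L ≤ (1 - β) * n * (n * A) :=
        mul_le_mul_of_nonneg_left hLA (by positivity)
      linarith
    rw [h3]
    calc c * ε ^ 2 / (2 * n) * V0 = ε * V0 / 2 * (c * ε / n) := by field_simp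
      _ ≤ _ := mul_le_mul_of_nonneg_left h4 (by positivity)
  have hδ0 : 0 ≤ c * ε ^ 2 / (2 * n) := by positivity
  have hVZ : (1 - 5 / 4 * ε) * T ≤ V0 - Z := by
    have h1 := mul_nonneg hδ0 hW0
    have h2 := mul_le_mul_of_nonneg_right hk hT0
    linarith
  constructor
  · rw [div_mul_eq_mul_div, le_div_iff₀ hpos]
    calc (1 - ε) * VP * (1 - β ^ n) = (1 - ε) * ((1 - β ^ n) * VP) := by ring
      _ ≤ (1 - ε) * T := mul_le_mul_of_nonneg_left hPT (by linarith)
      _ ≤ (1 + ε) * ((1 - 5 / 4 * ε) * T) := by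
        have : 0 ≤ ε * (3 / 4 - 5 / 4 * ε) * T :=
          mul_nonneg (mul_nonneg hε0.le (by linarith)) hT0
        linarith
      _ ≤ _ := mul_le_mul_of_nonneg_left hVZ (by linarith)
  · rw [div_mul_eq_mul_div, div_le_iff₀ hpos, mul_assoc]
    apply mul_le_mul_of_nonneg_left _ (by linarith)
    linarith
end

section
/- Let n ≥ 1, let c ∈ ℝⁿ and r satisfy 0 < r ≤ 1 and ‖c‖₁ ≤ r, and let M > 0. Define Ψ(u,v) as the Lebesgue measure of {x ∈ [−1,1]ⁿ : ∑_{i=1}^n |x_i| ≤ u and ∑_{i=1}^n |x_i − c_i| ≤ v}. Then Ψ(1, r) ≥ (M/(M+n))^{2n} · Ψ(1 + n/M, r·(1 + n/M)). -/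
open MeasureTheory
open scoped Pointwise

theorem stmt15 (n : ℕ) (hn : 1 ≤ n) (c : Fin n → ℝ) (r : ℝ)
    (hr0 : 0 < r) (hr1 : r ≤ 1) (hc : ∑ i, |c i| ≤ r) (M : ℝ) (hM : 0 < M)
    (Ψ : ℝ → ℝ → ℝ)
    (hΨ : ∀ u v : ℝ, Ψ u v = (volume {x : Fin n → ℝ |
        (∀ i, |x i| ≤ 1) ∧ (∑ i, |x i| ≤ u) ∧ (∑ i, |x i - c i| ≤ v)}).toReal) :
    (M / (M + n)) ^ (2 * n) * Ψ (1 + n / M) (r * (1 + n / M)) ≤ Ψ 1 r := by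
  have hn0 : (0 : ℝ) ≤ n / M := by positivity
  obtain ⟨t, ht⟩ : ∃ t : ℝ, t = 1 + n / M := ⟨_, rfl⟩
  have ht1 : 1 ≤ t := by linarith
  have hinv : M / (M + n) = 1 / t := by
    rw [ht]; field_simp
  rw [hinv, ← ht, hΨ, hΨ]
  set K := {x : Fin n → ℝ |
        (∀ i, |x i| ≤ 1) ∧ (∑ i, |x i| ≤ t) ∧ (∑ i, |x i - c i| ≤ r * t)} with hK
  set L := {x : Fin n → ℝ |
        (∀ i, |x i| ≤ 1) ∧ (∑ i, |x i| ≤ 1) ∧ (∑ i, |x i - c i| ≤ r)} with hL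
  obtain ⟨m, hm⟩ : ∃ m : ℝ, m = 1 / (2 * t - 1) := ⟨_, rfl⟩
  have h2t : 0 < 2 * t - 1 := by linarith
  have hm0 : 0 < m := by rw [hm]; positivity
  have hmt : m * (2 * t - 1) = 1 := by rw [hm]; field_simp
  have hmle : (1 / t) ^ 2 ≤ m := by
    rw [hm, div_pow, one_pow]
    apply one_div_le_one_div_of_le h2t
    nlinarith [sq_nonneg (t - 1)]
  have hmt1 : 0 ≤ m * (t - 1) := mul_nonneg hm0.le (by linarith)
  have hsub : m • K ⊆ (fun x => x + (m * (t - 1)) • c) ⁻¹' L := by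
    rintro _ ⟨y, ⟨-, hy1, hy2⟩, rfl⟩
    have A : ∑ i, |m * y i + m * (t - 1) * c i| ≤ 1 := by
      calc ∑ i, |m * y i + m * (t - 1) * c i|
          ≤ ∑ i, (m * |y i| + m * (t - 1) * |c i|) := by
            apply Finset.sum_le_sum; intro i _
            refine (abs_add_le _ _).trans ?_
            rw [abs_mul, abs_mul (m * (t - 1)), abs_of_nonneg hm0.le, abs_of_nonneg hmt1]
        _ = m * ∑ i, |y i| + m * (t - 1) * ∑ i, |c i| := by
            rw [Finset.sum_add_distrib, Finset.mul_sum, Finset.mul_sum]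
        _ ≤ m * t + m * (t - 1) * 1 := by
            gcongr; linarith
        _ = 1 := by linarith
    have B : ∑ i, |m * y i + m * (t - 1) * c i - c i| ≤ r := by
      calc ∑ i, |m * y i + m * (t - 1) * c i - c i|
          ≤ ∑ i, (m * |y i - c i| + m * (t - 1) * |c i|) := by
            apply Finset.sum_le_sum; intro i _
            have : m * y i + m * (t - 1) * c i - c i
              = m * (y i - c i) - m * (t - 1) * c i := by
              linear_combination c i * hmt
            rw [this]
            refine (abs_sub _ _).trans ?_
            rw [abs_mul, abs_mul (m * (t - 1)), abs_of_nonneg hm0.le, abs_of_nonneg hmt1]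
        _ = m * ∑ i, |y i - c i| + m * (t - 1) * ∑ i, |c i| := by
            rw [Finset.sum_add_distrib, Finset.mul_sum, Finset.mul_sum]
        _ ≤ m * (r * t) + m * (t - 1) * r := by
            gcongr
        _ = r := by linear_combination r * hmt
    refine ⟨fun i => ?_, A, B⟩
    exact (Finset.single_le_sum (f := fun i => |m * y i + m * (t - 1) * c i|)
      (fun j _ => abs_nonneg _) (Finset.mem_univ i)).trans A
  have hLfin : volume L ≠ ⊤ := by
    have : L ⊆ Set.Icc (fun _ => -1) (fun _ => 1) := fun x hx =>
      ⟨fun i => (abs_le.1 (hx.1 i)).1, fun i => (abs_le.1 (hx.1 i)).2⟩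
    exact ((measure_mono this).trans_lt isCompact_Icc.measure_lt_top).ne
  have hv := measure_mono (μ := volume) hsub
  rw [measure_preimage_add_right, Measure.addHaar_smul] at hv
  have hv2 := ENNReal.toReal_mono hLfin hv
  rw [ENNReal.toReal_mul, ENNReal.toReal_ofReal (abs_nonneg _), Module.finrank_fin_fun,
    abs_of_nonneg (by positivity)] at hv2
  refine le_trans ?_ hv2
  rw [pow_mul]
  gcongr
end

section
/- Let n ≥ 1, let a ∈ ℤⁿ have all entries positive, let σ ∈ {−1,1}ⁿ satisfy ⟨σ, a⟩ > 0, and let ε, δ satisfy 0 < ε < δ. Then Vol( C(δ·a, 1) ∩ C_σ(0, 1+ε) ∖ C(0,1) ) ≤ (ε/(n−1)!) · (1+ε)^{n−1}. -/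
open MeasureTheory

/-- The orthant piece `C_σ(c,r)` of the cross-polytope `C(c,r)`. -/
def crossPolytopeOrthant {n : ℕ} (σ : Fin n → ℝ) (c : Fin n → ℝ) (r : ℝ) :
    Set (Fin n → ℝ) :=
  {x ∈ crossPolytope c r | ∀ i, 0 ≤ σ i * (x i - c i)}

def shell18 (n : ℕ) (ε : ℝ) : Set (Fin n → ℝ) := {x | 1 < ∑ i, |x i| ∧ ∑ i, |x i| ≤ 1 + ε}

def piece18 (n : ℕ) (ε : ℝ) (s : Fin n → ℤˣ) : Set (Fin n → ℝ) :=
  shell18 n ε ∩ {x | ∀ i, 0 < (((s i : ℤˣ) : ℤ) : ℝ) * x i}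

theorem meas_shell18 (n : ℕ) (ε : ℝ) : MeasurableSet (shell18 n ε) := by
  have h : Measurable (fun x : Fin n → ℝ => ∑ i, |x i|) :=
    (by fun_prop : Continuous (fun x : Fin n → ℝ => ∑ i, |x i|)).measurable
  exact (measurableSet_lt measurable_const h).inter (measurableSet_le h measurable_const)

theorem meas_piece18 (n : ℕ) (ε : ℝ) (s : Fin n → ℤˣ) : MeasurableSet (piece18 n ε s) := by
  refine (meas_shell18 n ε).inter ?_
  rw [Set.ofPred_forall]
  exact MeasurableSet.iInter fun i =>
    measurableSet_lt measurable_const ((measurable_pi_apply i).const_mul _)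

theorem vol_ball18 (n : ℕ) (hn : 1 ≤ n) (r : ℝ) :
    volume {x : Fin n → ℝ | ∑ i, |x i| ≤ r} =
      ENNReal.ofReal r ^ n * ENNReal.ofReal (2 ^ n / n.factorial) := by
  have : Nonempty (Fin n) := ⟨⟨0, hn⟩⟩
  have h := volume_sum_rpow_le (Fin n) (p := 1) le_rfl r
  have g : Real.Gamma (1 + 1) = 1 := by simpa using Real.Gamma_nat_eq_factorial 1
  simpa [Real.Gamma_nat_eq_factorial, g] using h

theorem abs_unit18 (u : ℤˣ) (x : ℝ) : |((u : ℤ) : ℝ) * x| = |x| := by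
  rcases Int.units_eq_one_or u with h | h <;> simp [h]

theorem mp_unit18 (n : ℕ) (s : Fin n → ℤˣ) :
    MeasurePreserving (fun (x : Fin n → ℝ) i => (((s i : ℤˣ) : ℤ) : ℝ) * x i) volume volume := by
  refine volume_preserving_pi (f := fun i (y : ℝ) => (((s i : ℤˣ) : ℤ) : ℝ) * y) fun i => ?_
  rcases Int.units_eq_one_or (s i) with h | h
  · simp only [h, Units.val_one, Int.cast_one, one_mul]
    exact MeasurePreserving.id (volume : Measure ℝ)
  · simpa [h] using Measure.measurePreserving_neg (volume : Measure ℝ)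

theorem piece_eq18 (n : ℕ) (ε : ℝ) (s : Fin n → ℤˣ) :
    volume (piece18 n ε s) = volume (piece18 n ε 1) := by
  rw [← (mp_unit18 n s).measure_preimage (meas_piece18 n ε 1).nullMeasurableSet]
  congr 1
  ext x
  simp [piece18, shell18, abs_unit18, -abs_mul]

theorem disj18 (n : ℕ) (ε : ℝ) : Pairwise (Function.onFun Disjoint (piece18 n ε)) := by
  intro s t hst
  rw [Function.onFun, Set.disjoint_left]
  rintro x ⟨_, h1⟩ ⟨_, h2⟩
  apply hst
  funext i
  have h1 := h1 i
  have h2 := h2 i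
  rcases Int.units_eq_one_or (s i) with h | h <;> rcases Int.units_eq_one_or (t i) with h' | h' <;>
    simp [h, h'] at h1 h2 ⊢ <;> linarith

theorem sum18 (n : ℕ) (ε : ℝ) (s : Fin n → ℤˣ) :
    2 ^ n * volume (piece18 n ε s) ≤ volume (shell18 n ε) := by
  have h := measure_iUnion (μ := volume) (disj18 n ε) (meas_piece18 n ε)
  have h2 : volume (⋃ t, piece18 n ε t) ≤ volume (shell18 n ε) :=
    measure_mono (Set.iUnion_subset fun t => Set.inter_subset_left)
  rw [h, tsum_fintype, Finset.sum_congr rfl (fun t _ => (piece_eq18 n ε t).trans (piece_eq18 n ε s).symm)] at h2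
  simpa using h2

theorem vol_shell18 (n : ℕ) (hn : 1 ≤ n) (ε : ℝ) (hε : 0 < ε) :
    volume (shell18 n ε) = ENNReal.ofReal (((1 + ε) ^ n - 1) * (2 ^ n / n.factorial)) := by
  have hs : shell18 n ε = {x | ∑ i, |x i| ≤ 1 + ε} \ {x | ∑ i, |x i| ≤ 1} := by
    ext x; simp [shell18, and_comm]
  have hm : MeasurableSet {x : Fin n → ℝ | ∑ i, |x i| ≤ 1} :=
    measurableSet_le (by fun_prop : Continuous (fun x : Fin n → ℝ => ∑ i, |x i|)).measurable
      measurable_const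
  have hsub : {x : Fin n → ℝ | ∑ i, |x i| ≤ 1} ⊆ {x | ∑ i, |x i| ≤ 1 + ε} := by
    intro x hx
    simp only [Set.mem_ofPred_eq] at hx ⊢
    linarith
  rw [hs, measure_sdiff hsub hm.nullMeasurableSet
    (by rw [vol_ball18 n hn]; finiteness), vol_ball18 n hn, vol_ball18 n hn,
    ← ENNReal.ofReal_pow (by linarith), ← ENNReal.ofReal_mul (by positivity), sub_mul,
    ENNReal.ofReal_sub _ (by positivity)]
  simp

theorem pow18 (m : ℕ) (ε : ℝ) (hε : 0 < ε) :
    (1 + ε) ^ (m + 1) - 1 ≤ (m + 1) * ε * (1 + ε) ^ m := by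
  induction m with
  | zero => simp
  | succ k ih =>
    have : (1:ℝ) ≤ (1 + ε) ^ (k+1) := one_le_pow₀ (by linarith)
    push_cast
    have h2 := mul_le_mul_of_nonneg_right ih (by linarith : 0 ≤ 1 + ε)
    have e : (1 + ε) ^ (k + 1 + 1) = (1 + ε) ^ (k + 1) * (1 + ε) := pow_succ _ _
    have e' : (1 + ε) ^ (k + 1) = (1 + ε) ^ k * (1 + ε) := pow_succ _ _
    rw [e]
    have h3 : ((k + 1) * ε * (1 + ε) ^ k) * (1 + ε) = (k + 1) * ε * (1 + ε) ^ (k + 1) := by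
      rw [e']; ring
    nlinarith

theorem stmt18 (n : ℕ) (hn : 1 ≤ n) (a : Fin n → ℤ) (hapos : ∀ i, 0 < a i)
    (σ : Fin n → ℝ) (hσ : ∀ i, σ i = 1 ∨ σ i = -1)
    (hσa : 0 < ∑ i, σ i * (a i : ℝ))
    (ε δ : ℝ) (hε : 0 < ε) (hεδ : ε < δ) :
    (volume ((crossPolytope (δ • fun i => (a i : ℝ)) 1 ∩
        crossPolytopeOrthant σ (0 : Fin n → ℝ) (1 + ε)) \
        crossPolytope (0 : Fin n → ℝ) 1)).toReal
      ≤ ε / ((n - 1).factorial : ℝ) * (1 + ε) ^ (n - 1) := by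
  have hs : ∀ i, ∃ u : ℤˣ, σ i = ((u : ℤ) : ℝ) := fun i => by
    rcases hσ i with h | h
    · exact ⟨1, by simp [h]⟩
    · exact ⟨-1, by simp [h]⟩
  choose s hs using hs
  have hsub : ((crossPolytope (δ • fun i => (a i : ℝ)) 1 ∩
        crossPolytopeOrthant σ (0 : Fin n → ℝ) (1 + ε)) \
        crossPolytope (0 : Fin n → ℝ) 1) ⊆ piece18 n ε s ∪ ⋃ i, {x : Fin n → ℝ | x i = 0} := by
    rintro x ⟨⟨_, h1, h2⟩, h3⟩
    by_cases hx : ∃ i, x i = 0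
    · right; simpa using hx
    · left
      push Not at hx
      simp only [crossPolytope, Set.mem_ofPred_eq, Pi.zero_apply, sub_zero, not_le] at h1 h2 h3
      refine ⟨⟨h3, h1⟩, fun i => ?_⟩
      rw [← hs i]
      refine lt_of_le_of_ne (h2 i) (Ne.symm (mul_ne_zero ?_ (hx i)))
      rcases hσ i with h | h <;> simp [h]
  have hnull : volume (⋃ i, {x : Fin n → ℝ | x i = 0}) = 0 :=
    measure_iUnion_null fun i => Measure.pi_hyperplane (fun _ => (volume : Measure ℝ)) i 0
  have hle := (measure_mono (μ := volume) hsub).trans (measure_union_le _ _)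
  rw [hnull, add_zero] at hle
  have hsum := sum18 n ε s
  rw [vol_shell18 n hn ε hε] at hsum
  have hpne : volume (piece18 n ε s) ≠ ⊤ := by
    intro h
    rw [h, ENNReal.mul_top (by simp)] at hsum
    exact ENNReal.ofReal_ne_top (top_le_iff.mp hsum)
  have h1 := ENNReal.toReal_mono hpne hle
  have h1e : (1:ℝ) ≤ (1 + ε) ^ n := one_le_pow₀ (by linarith)
  have h2 := ENNReal.toReal_mono ENNReal.ofReal_ne_top hsum
  rw [ENNReal.toReal_ofReal (mul_nonneg (by linarith) (by positivity))] at h2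
  simp only [ENNReal.toReal_mul, ENNReal.toReal_pow, ENNReal.toReal_ofNat] at h2
  refine h1.trans ?_
  have h3 : (volume (piece18 n ε s)).toReal ≤ ((1 + ε) ^ n - 1) / n.factorial := by
    have : (0:ℝ) < 2 ^ n := by positivity
    refine le_of_mul_le_mul_left (h2.trans (le_of_eq ?_)) this
    ring
  refine h3.trans ?_
  obtain ⟨m, rfl⟩ : ∃ m, n = m + 1 := ⟨n - 1, by omega⟩
  have h4 := pow18 m ε hε
  have hf : (0:ℝ) < (m.factorial : ℝ) := by positivity
  rw [Nat.add_sub_cancel, Nat.factorial_succ, div_le_iff₀ (by positivity)]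
  refine h4.trans (le_of_eq ?_)
  push_cast
  field_simp
end
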